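/- arXiv:2009.05003 — 7 statements merged into one kernel-verified Lean document; each statement's English description precedes it below -/
import Mathlib

section
/- For every continuous function B : ℝ → ℝ, every s ∈ ℝ, every λ ∈ ℂ and every (c₁, c₂) ∈ ℂ², there exists exactly one continuous function Φ : ℝ → ℂ satisfying the stochastic Airy equation based at s with data (c₁, c₂), i.e. Φ(t) = c₂ + c₁·𝒰_λ(t,s) + ∫_s^t 𝒰_λ(t,u)·Φ(u) du for all t ∈ ℝ. Moreover, writing Φ_λ for this solution, the map (λ, t) ↦ Φ_λ(t) is jointly continuous on ℂ × ℝ, and for each fixed t ∈ ℝ the map λ ↦ Φ_λ(t) is entire. -/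
open MeasureTheory Filter Topology Set

/-- The kernel `𝒰_λ(t,u) = (t² − u²)/2 + B(t) − B(u) + λ(t − u)`. -/
noncomputable def Uker (B : ℝ → ℝ) (lam : ℂ) (t u : ℝ) : ℂ :=
  (((t ^ 2 - u ^ 2) / 2 + B t - B u : ℝ) : ℂ) + lam * ((t : ℂ) - (u : ℂ))

/-- `Φ` is a (continuous) solution of the stochastic Airy equation based at `s`
with data `(c₁, c₂)`:  `Φ(t) = c₂ + c₁·𝒰_λ(t,s) + ∫_s^t 𝒰_λ(t,u)·Φ(u) du`. -/
def IsSAESol (B : ℝ → ℝ) (lam : ℂ) (s : ℝ) (c₁ c₂ : ℂ) (Φ : ℝ → ℂ) : Prop :=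
  Continuous Φ ∧
    ∀ t : ℝ, Φ t = c₂ + c₁ * Uker B lam t s + ∫ u in s..t, Uker B lam t u * Φ u

/-- The terms of the Neumann series of the Volterra equation
`Φ z t = g z t + ∫ u in s..t, K z t u * Φ z u`. -/
noncomputable def volterraTerm (K : ℂ → ℝ → ℝ → ℂ) (g : ℂ → ℝ → ℂ) (s : ℝ) : ℕ → ℂ → ℝ → ℂ
  | 0 => g
  | n + 1 => fun z t => ∫ u in s..t, K z t u * volterraTerm K g s n z u

theorem norm_integral_mul_le_pow_div_factorial {k f : ℝ → ℂ} {s t M C : ℝ} {n : ℕ}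
    (hM : 0 ≤ M) (hk : ∀ u ∈ uIoc s t, ‖k u‖ ≤ M)
    (hf : ∀ u ∈ uIoc s t, ‖f u‖ ≤ C * ((M * |u - s|) ^ n / n.factorial)) :
    ‖∫ u in s..t, k u * f u‖ ≤ C * ((M * |t - s|) ^ (n + 1) / (n + 1).factorial) := by
  have hint : IntegrableOn (fun u : ℝ => M * (C * ((M * |u - s|) ^ n / n.factorial)))
      (uIoc s t) := by
    rw [← intervalIntegrable_iff]
    exact Continuous.intervalIntegrable (by fun_prop) _ _
  calc ‖∫ u in s..t, k u * f u‖ = ‖∫ u in uIoc s t, k u * f u‖ :=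
        intervalIntegral.norm_integral_eq_norm_integral_uIoc _
    _ ≤ ∫ u in uIoc s t, M * (C * ((M * |u - s|) ^ n / n.factorial)) := by
        refine norm_integral_le_of_norm_le hint ?_
        refine (ae_restrict_iff' measurableSet_uIoc).2 (ae_of_all _ fun u hu => ?_)
        rw [norm_mul]
        exact mul_le_mul (hk u hu) (hf u hu) (norm_nonneg _) hM
    _ = ∫ u in uIoc s t, (C * M ^ (n + 1) / n.factorial) * |u - s| ^ n := by
        congr 1 with u
        ring
    _ = C * ((M * |t - s|) ^ (n + 1) / (n + 1).factorial) := by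
        rw [integral_const_mul, integral_pow_abs_sub_uIoc, Nat.factorial_succ]
        push_cast
        field_simp
        ring

theorem abs_sub_le_of_mem_uIoc {s t u : ℝ} (hu : u ∈ uIoc s t) : |u - s| ≤ |t - s| :=
  abs_sub_left_of_mem_uIcc (uIoc_subset_uIcc hu)

theorem eq_zero_of_eq_volterra_integral {k : ℝ → ℝ → ℂ} (hk : Continuous k.uncurry)
    {D : ℝ → ℂ} (hD : Continuous D) {s : ℝ} (h : ∀ t, D t = ∫ u in s..t, k t u * D u) :
    D = 0 := by
  funext t₀
  set R := |t₀ - s|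
  have hcpt : IsCompact (Metric.closedBall s R) := isCompact_closedBall _ _
  obtain ⟨M, hM⟩ := (hcpt.prod hcpt).exists_bound_of_continuousOn hk.continuousOn
  obtain ⟨C, hC⟩ := hcpt.exists_bound_of_continuousOn hD.continuousOn
  have hs : s ∈ Metric.closedBall s R := Metric.mem_closedBall_self (abs_nonneg _)
  have hM0 : 0 ≤ M := (norm_nonneg _).trans (hM (s, s) ⟨hs, hs⟩)
  have key : ∀ n : ℕ, ∀ t, |t - s| ≤ R → ‖D t‖ ≤ C * ((M * |t - s|) ^ n / n.factorial) := by
    intro n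
    induction n with
    | zero => intro t ht; simpa using hC t ht
    | succ n ih =>
      intro t ht
      rw [h t]
      exact norm_integral_mul_le_pow_div_factorial hM0
        (fun u hu => hM (t, u) ⟨ht, (abs_sub_le_of_mem_uIoc hu).trans ht⟩)
        fun u hu => ih u ((abs_sub_le_of_mem_uIoc hu).trans ht)
  have hlim := (FloorSemiring.tendsto_pow_div_factorial_atTop (M * R)).const_mul C
  rw [mul_zero] at hlim
  exact norm_le_zero_iff.1 (ge_of_tendsto' hlim fun n => key n t₀ le_rfl)

theorem continuous_volterraTerm {K : ℂ → ℝ → ℝ → ℂ} {g : ℂ → ℝ → ℂ}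
    (hK : Continuous fun p : ℂ × ℝ × ℝ => K p.1 p.2.1 p.2.2)
    (hg : Continuous fun p : ℂ × ℝ => g p.1 p.2) (s : ℝ) (n : ℕ) :
    Continuous fun p : ℂ × ℝ => volterraTerm K g s n p.1 p.2 := by
  induction n with
  | zero => exact hg
  | succ n ih =>
    refine intervalIntegral.continuous_parametric_intervalIntegral_of_continuous
      (f := fun (p : ℂ × ℝ) u => K p.1 p.2 u * volterraTerm K g s n p.1 u) ?_ continuous_snd
    exact (hK.comp (f := fun q : (ℂ × ℝ) × ℝ => (q.1.1, q.1.2, q.2)) (by fun_prop)).mul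
      (ih.comp (f := fun q : (ℂ × ℝ) × ℝ => (q.1.1, q.2)) (by fun_prop))

theorem exists_summable_bound_volterraTerm {K : ℂ → ℝ → ℝ → ℂ} {g : ℂ → ℝ → ℂ}
    (hK : Continuous fun p : ℂ × ℝ × ℝ => K p.1 p.2.1 p.2.2)
    (hg : Continuous fun p : ℂ × ℝ => g p.1 p.2) (s R : ℝ) :
    ∃ b : ℕ → ℝ, Summable b ∧ ∀ n, ∀ z ∈ Metric.closedBall (0 : ℂ) R,
      ∀ t ∈ Metric.closedBall s R, ‖volterraTerm K g s n z t‖ ≤ b n := by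
  have hz : IsCompact (Metric.closedBall (0 : ℂ) R) := isCompact_closedBall _ _
  have ht : IsCompact (Metric.closedBall s R) := isCompact_closedBall _ _
  obtain ⟨M, hM⟩ := (hz.prod (ht.prod ht)).exists_bound_of_continuousOn hK.continuousOn
  obtain ⟨C, hC⟩ := (hz.prod ht).exists_bound_of_continuousOn hg.continuousOn
  refine ⟨fun n => C * ((M * R) ^ n / n.factorial),
    (Real.summable_pow_div_factorial _).mul_left C, fun n z hz t ht => ?_⟩
  have hM0 : 0 ≤ M := (norm_nonneg _).trans (hM (z, t, t) ⟨hz, ht, ht⟩)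
  have hC0 : 0 ≤ C := (norm_nonneg _).trans (hC (z, t) ⟨hz, ht⟩)
  have key : ‖volterraTerm K g s n z t‖ ≤ C * ((M * |t - s|) ^ n / n.factorial) := by
    induction n generalizing t with
    | zero => simpa [volterraTerm] using hC (z, t) ⟨hz, ht⟩
    | succ n ih =>
      have hu : ∀ u ∈ uIoc s t, u ∈ Metric.closedBall s R := fun u hu =>
        (abs_sub_le_of_mem_uIoc hu).trans ht
      exact norm_integral_mul_le_pow_div_factorial hM0
        (fun u h => hM (z, t, u) ⟨hz, ht, hu u h⟩) fun u h => ih u (hu u h)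
  refine key.trans ?_
  have : |t - s| ≤ R := ht
  beta_reduce
  gcongr

theorem differentiable_intervalIntegral_of_continuous {f : ℂ → ℝ → ℂ}
    (hf : Continuous f.uncurry) (hd : ∀ u, Differentiable ℂ fun z => f z u) (a b : ℝ) :
    Differentiable ℂ fun z => ∫ u in a..b, f z u := by
  intro z₀
  obtain ⟨C, hC⟩ := ((isCompact_closedBall z₀ 2).prod
    (isCompact_uIcc (a := a) (b := b))).exists_bound_of_continuousOn hf.continuousOn
  have hcont : ∀ z, Continuous (f z) := fun z => hf.comp (by fun_prop : Continuous fun u => (z, u))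
  have hmeas : StronglyMeasurable fun u => deriv (fun z => f z u) z₀ :=
    (stronglyMeasurable_deriv_with_param (f := fun u z => f z u)
      (hf.comp continuous_swap)).comp_measurable (by fun_prop : Measurable fun u : ℝ => (u, z₀))
  refine (intervalIntegral.hasDerivAt_integral_of_dominated_loc_of_deriv_le
    (F' := fun z u => deriv (fun z => f z u) z) (bound := fun _ => C)
    (Metric.ball_mem_nhds z₀ one_pos)
    (Eventually.of_forall fun z => (hcont z).aestronglyMeasurable)
    ((hcont z₀).intervalIntegrable _ _) hmeas.aestronglyMeasurable
    (ae_of_all _ fun u hu z hz => ?_) intervalIntegrable_const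
    (ae_of_all _ fun u _ z _ => (hd u z).hasDerivAt)).2.differentiableAt
  have := Complex.norm_deriv_le_of_forall_mem_sphere_norm_le (f := fun z => f z u) (c := z)
    (C := C) one_pos (hd u).diffContOnCl fun w hw => hC (w, u) ⟨?_, uIoc_subset_uIcc hu⟩
  · simpa using this
  · have h1 : dist w z = 1 := hw
    have h2 : dist z z₀ < 1 := hz
    change dist w z₀ ≤ 2
    linarith [dist_triangle w z z₀]

theorem differentiable_volterraTerm {K : ℂ → ℝ → ℝ → ℂ} {g : ℂ → ℝ → ℂ}
    (hK : Continuous fun p : ℂ × ℝ × ℝ => K p.1 p.2.1 p.2.2)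
    (hg : Continuous fun p : ℂ × ℝ => g p.1 p.2)
    (hK' : ∀ t u, Differentiable ℂ fun z => K z t u)
    (hg' : ∀ t, Differentiable ℂ fun z => g z t) (s : ℝ) (n : ℕ) (t : ℝ) :
    Differentiable ℂ fun z => volterraTerm K g s n z t := by
  induction n generalizing t with
  | zero => exact hg' t
  | succ n ih =>
    refine differentiable_intervalIntegral_of_continuous
      (f := fun z u => K z t u * volterraTerm K g s n z u) ?_ (fun u => (hK' t u).mul (ih u)) s t
    exact (hK.comp (f := fun q : ℂ × ℝ => (q.1, t, q.2)) (by fun_prop)).mul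
      (continuous_volterraTerm hK hg s n)

/-- A Volterra equation whose kernel and free term are jointly continuous and entire in the
parameter `z` has a solution that is jointly continuous and entire in `z`. -/
theorem exists_volterra_solution {K : ℂ → ℝ → ℝ → ℂ} {g : ℂ → ℝ → ℂ}
    (hK : Continuous fun p : ℂ × ℝ × ℝ => K p.1 p.2.1 p.2.2)
    (hg : Continuous fun p : ℂ × ℝ => g p.1 p.2)
    (hK' : ∀ t u, Differentiable ℂ fun z => K z t u)
    (hg' : ∀ t, Differentiable ℂ fun z => g z t) (s : ℝ) :
    ∃ F : ℂ → ℝ → ℂ, (∀ z t, F z t = g z t + ∫ u in s..t, K z t u * F z u) ∧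
      Continuous (fun p : ℂ × ℝ => F p.1 p.2) ∧ ∀ t, Differentiable ℂ fun z => F z t := by
  have hT := continuous_volterraTerm hK hg s
  refine ⟨fun z t => ∑' n, volterraTerm K g s n z t, fun z t => ?_, ?_, fun t z₀ => ?_⟩
  · obtain ⟨b, hb, hle⟩ := exists_summable_bound_volterraTerm hK hg s (max ‖z‖ |t - s|)
    have hz : z ∈ Metric.closedBall (0 : ℂ) (max ‖z‖ |t - s|) := by simp
    have ht : ∀ u, |u - s| ≤ |t - s| → u ∈ Metric.closedBall s (max ‖z‖ |t - s|) :=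
      fun u hu => hu.trans (le_max_right _ _)
    have hsum : ∀ u, |u - s| ≤ |t - s| → Summable fun n => volterraTerm K g s n z u :=
      fun u hu => .of_norm_bounded hb fun n => hle n z hz u (ht u hu)
    have hKc : Continuous (K z t) := hK.comp (f := fun u : ℝ => (z, t, u)) (by fun_prop)
    have hTc : ∀ n, Continuous (volterraTerm K g s n z) := fun n =>
      (hT n).comp (f := fun u : ℝ => (z, u)) (by fun_prop)
    have hint : HasSum (fun n => ∫ u in s..t, K z t u * volterraTerm K g s n z u)
        (∫ u in s..t, K z t u * ∑' n, volterraTerm K g s n z u) := by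
      refine intervalIntegral.hasSum_integral_of_dominated_convergence
        (fun n u => ‖K z t u‖ * b n) (fun n => (hKc.mul (hTc n)).aestronglyMeasurable)
        (fun n => ae_of_all _ fun u hu => ?_) (ae_of_all _ fun u _ => hb.mul_left _) ?_
        (ae_of_all _ fun u hu => (hsum u (abs_sub_le_of_mem_uIoc hu)).hasSum.mul_left _)
      · rw [norm_mul]
        gcongr
        exact hle n z hz u (ht u (abs_sub_le_of_mem_uIoc hu))
      · simp_rw [tsum_mul_left]
        exact (hKc.norm.mul_const _).intervalIntegrable _ _
    beta_reduce
    rw [(hsum t le_rfl).tsum_eq_zero_add, ← hint.tsum_eq]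
    rfl
  · refine continuous_iff_continuousAt.2 fun ⟨z₀, t₀⟩ => ?_
    set R := max ‖z₀‖ |t₀ - s| + 1
    obtain ⟨b, hb, hle⟩ := exists_summable_bound_volterraTerm hK hg s R
    refine (continuousOn_tsum (s := Metric.closedBall 0 R ×ˢ Metric.closedBall s R)
      (fun n => (hT n).continuousOn) hb fun n p hp => hle n _ hp.1 _ hp.2).continuousAt ?_
    refine prod_mem_nhds (Metric.closedBall_mem_nhds_of_mem ?_)
      (Metric.closedBall_mem_nhds_of_mem ?_)
    · simpa using (le_max_left ‖z₀‖ |t₀ - s|).trans_lt (lt_add_one _)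
    · exact (le_max_right ‖z₀‖ |t₀ - s|).trans_lt (lt_add_one _)
  · set R := max (‖z₀‖ + 1) |t - s|
    obtain ⟨b, hb, hle⟩ := exists_summable_bound_volterraTerm hK hg s R
    refine (Complex.differentiableOn_tsum_of_summable_norm (U := Metric.ball 0 R) hb
      (fun n => (differentiable_volterraTerm hK hg hK' hg' s n t).differentiableOn)
      Metric.isOpen_ball fun n w hw => hle n w (Metric.ball_subset_closedBall hw) t
        (le_max_right (‖z₀‖ + 1) |t - s|)).differentiableAt (Metric.isOpen_ball.mem_nhds ?_)
    exact mem_ball_zero_iff.2 ((lt_add_one ‖z₀‖).trans_le (le_max_left _ |t - s|))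

theorem continuous_Uker {B : ℝ → ℝ} (hB : Continuous B) :
    Continuous fun p : ℂ × ℝ × ℝ => Uker B p.1 p.2.1 p.2.2 := by
  unfold Uker
  fun_prop

theorem IsSAESol.eq {B : ℝ → ℝ} (hB : Continuous B) {lam : ℂ} {s : ℝ} {c₁ c₂ : ℂ}
    {Φ Ψ : ℝ → ℂ} (hΦ : IsSAESol B lam s c₁ c₂ Φ) (hΨ : IsSAESol B lam s c₁ c₂ Ψ) : Φ = Ψ := by
  have hk : Continuous (Uker B lam).uncurry :=
    (continuous_Uker hB).comp (f := fun q : ℝ × ℝ => (lam, q.1, q.2)) (by fun_prop)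
  refine sub_eq_zero.1 (eq_zero_of_eq_volterra_integral (s := s) hk (hΦ.1.sub hΨ.1) fun t => ?_)
  have ⟨hΦc, _⟩ := hΦ
  have ⟨hΨc, _⟩ := hΨ
  have hkt : Continuous (Uker B lam t) := hk.comp (f := fun u : ℝ => (t, u)) (by fun_prop)
  simp_rw [Pi.sub_apply, mul_sub]
  rw [intervalIntegral.integral_sub (Continuous.intervalIntegrable (by fun_prop) _ _)
    (Continuous.intervalIntegrable (by fun_prop) _ _), hΦ.2 t, hΨ.2 t]
  ring


/-- Existence, uniqueness, joint continuity of the solution of the stochastic Airy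
equation, and analyticity in the parameter `λ`. -/
theorem stmt1 (B : ℝ → ℝ) (hB : Continuous B) (s : ℝ) (c₁ c₂ : ℂ) :
    (∀ lam : ℂ, ∃! Φ : ℝ → ℂ, IsSAESol B lam s c₁ c₂ Φ) ∧
    (∃ F : ℂ → ℝ → ℂ, (∀ lam : ℂ, IsSAESol B lam s c₁ c₂ (F lam)) ∧
      Continuous (fun p : ℂ × ℝ => F p.1 p.2) ∧
      ∀ t : ℝ, Differentiable ℂ fun lam => F lam t) := by
  have hU := continuous_Uker hB
  have hU' : ∀ t u, Differentiable ℂ fun lam => Uker B lam t u := fun t u => by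
    unfold Uker
    fun_prop
  obtain ⟨F, hF, hFc, hFd⟩ := exists_volterra_solution
    (g := fun lam t => c₂ + c₁ * Uker B lam t s) hU
    (by
      have := hU.comp (f := fun p : ℂ × ℝ => (p.1, p.2, s)) (by fun_prop)
      exact continuous_const.add (continuous_const.mul this))
    hU' (fun t => ((hU' t s).const_mul c₁).const_add c₂) s
  have hsol : ∀ lam, IsSAESol B lam s c₁ c₂ (F lam) := fun lam =>
    ⟨hFc.comp (f := fun t : ℝ => (lam, t)) (by fun_prop), hF lam⟩
  exact ⟨fun lam => ⟨F lam, hsol lam, fun Φ hΦ => hΦ.eq hB (hsol lam)⟩, F, hsol, hFc, hFd⟩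
end

section
/- Let B : ℝ → ℝ be continuous, λ ∈ ℂ, s₁, s₂ ∈ ℝ and (c₁₁, c₁₂) ∈ ℂ². If Φ : ℝ → ℂ is the solution of the stochastic Airy equation based at s₁ with data (c₁₁, c₁₂), then Φ is also the solution of the stochastic Airy equation based at s₂ with data (c₂₁, c₂₂), where c₂₁ = c₁₁ + ∫_{s₁}^{s₂} Φ(u) du and c₂₂ = Φ(s₂). In particular, the two-dimensional space of solutions of the stochastic Airy equation does not depend on the choice of base point. -/
open MeasureTheory Filter Topology Set

/-- The kernel is additive along concatenation of intervals. -/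
theorem Uker_add (B : ℝ → ℝ) (lam : ℂ) (t r u : ℝ) :
    Uker B lam t r + Uker B lam r u = Uker B lam t u := by
  simp only [Uker]
  push_cast
  ring

theorem continuous_Uker_right {B : ℝ → ℝ} (hB : Continuous B) (lam : ℂ) (t : ℝ) :
    Continuous (Uker B lam t) := by
  unfold Uker
  fun_prop

/-- Change of base point for the stochastic Airy equation: a solution based at `s₁`
with data `(c₁₁, c₁₂)` is also the solution based at `s₂` with data
`(c₁₁ + ∫_{s₁}^{s₂} Φ, Φ(s₂))`. -/
theorem stmt2 (B : ℝ → ℝ) (hB : Continuous B) (lam : ℂ) (s₁ s₂ : ℝ) (c₁₁ c₁₂ : ℂ)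
    (Φ : ℝ → ℂ) (h : IsSAESol B lam s₁ c₁₁ c₁₂ Φ) :
    IsSAESol B lam s₂ (c₁₁ + ∫ u in s₁..s₂, Φ u) (Φ s₂) Φ := by
  obtain ⟨hΦ, hsol⟩ := h
  have hint (r a b : ℝ) : IntervalIntegrable (fun u => Uker B lam r u * Φ u) volume a b :=
    ((continuous_Uker_right hB lam r).mul hΦ).intervalIntegrable a b
  refine ⟨hΦ, fun t => ?_⟩
  have hsplit : ∫ u in s₁..s₂, Uker B lam t u * Φ u =
      Uker B lam t s₂ * (∫ u in s₁..s₂, Φ u) + ∫ u in s₁..s₂, Uker B lam s₂ u * Φ u := by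
    rw [← intervalIntegral.integral_const_mul, ← intervalIntegral.integral_add
      ((hΦ.intervalIntegrable s₁ s₂).const_mul _) (hint s₂ s₁ s₂)]
    simp only [← add_mul, Uker_add]
  rw [hsol t, hsol s₂, ← intervalIntegral.integral_add_adjacent_intervals
    (hint t s₁ s₂) (hint t s₂ t), hsplit, ← Uker_add B lam t s₂ s₁]
  ring
end

section
/- Let B : ℝ → ℝ be continuous and λ ∈ ℂ. Define the stochastic Airy kernel 𝔄_λ(t,u) = f_{λ,0}(t)·g_{λ,0}(u) − f_{λ,0}(u)·g_{λ,0}(t) for t, u ∈ ℝ. Then for every s ∈ ℝ and all t, u ∈ ℝ one has 𝔄_λ(t,u) = f_{λ,s}(t)·g_{λ,s}(u) − f_{λ,s}(u)·g_{λ,s}(t). Consequently, for all t, u ∈ ℝ: 𝔄_λ(t,u) = g_{λ,t}(u) = −g_{λ,u}(t), ∂_u 𝔄_λ(t,u) = f_{λ,u}(t), ∂_t 𝔄_λ(t,u) = −f_{λ,t}(u), and ∂²_{tu} 𝔄_λ(t,u) = f'_{λ,u}(t) = −f'_{λ,t}(u). -/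
open MeasureTheory Filter Topology Set

/-- The primitive `c₁ + ∫_s^t Φ` of a solution of the stochastic Airy equation has derivative `Φ`. -/
theorem IsSAESol.hasDerivAt {B : ℝ → ℝ} {lam : ℂ} {s : ℝ} {c₁ c₂ : ℂ} {Φ φ : ℝ → ℂ}
    (h : IsSAESol B lam s c₁ c₂ Φ) (hφ : ∀ t, φ t = c₁ + ∫ u in s..t, Φ u) (t : ℝ) :
    HasDerivAt φ (Φ t) t := by
  rw [show φ = fun t => c₁ + ∫ u in s..t, Φ u from funext hφ]
  exact (h.1.integral_hasStrictDerivAt s t).hasDerivAt.const_add c₁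

/-- The initial value of a solution of the stochastic Airy equation. -/
theorem IsSAESol.apply_base {B : ℝ → ℝ} {lam : ℂ} {s : ℝ} {c₁ c₂ : ℂ} {Φ : ℝ → ℂ}
    (h : IsSAESol B lam s c₁ c₂ Φ) : Φ s = c₂ := by
  rw [h.2 s]
  simp [Uker]

/-- With `b(t) = 𝒰_λ(t,0)`, the quasi-derivative `Φ − bφ` of a solution has derivative `−bΦ`. -/
theorem IsSAESol.hasDerivAt_quasiDeriv {B : ℝ → ℝ} (hB : Continuous B) {lam : ℂ} {s : ℝ}
    {c₁ c₂ : ℂ} {Φ φ : ℝ → ℂ} (h : IsSAESol B lam s c₁ c₂ Φ)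
    (hφ : ∀ t, φ t = c₁ + ∫ u in s..t, Φ u) (t : ℝ) :
    HasDerivAt (fun x => Φ x - Uker B lam x 0 * φ x) (-(Uker B lam t 0 * Φ t)) t := by
  have hb : Continuous fun x => Uker B lam x 0 := by
    unfold Uker
    fun_prop
  have hbΦ : Continuous fun x => Uker B lam x 0 * Φ x := hb.mul h.1
  have hker (x u : ℝ) : Uker B lam x u = Uker B lam x 0 - Uker B lam u 0 := by
    simp only [Uker]
    push_cast
    ring
  have key : (fun x => Φ x - Uker B lam x 0 * φ x) =
      fun x => (c₂ - c₁ * Uker B lam s 0) - ∫ u in s..x, Uker B lam u 0 * Φ u := by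
    funext x
    have hint : ∫ u in s..x, Uker B lam x u * Φ u =
        Uker B lam x 0 * (∫ u in s..x, Φ u) - ∫ u in s..x, Uker B lam u 0 * Φ u := by
      rw [← intervalIntegral.integral_const_mul, ← intervalIntegral.integral_sub
        ((h.1.const_mul (Uker B lam x 0)).intervalIntegrable _ _) (hbΦ.intervalIntegrable _ _)]
      refine intervalIntegral.integral_congr fun u _ => ?_
      simp only [hker x u]
      ring
    rw [h.2 x, hφ x, hint, hker x s]
    ring
  rw [key]
  exact (hbΦ.integral_hasStrictDerivAt s t).hasDerivAt.const_sub _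

/-- The Wronskian of two solutions of the stochastic Airy equation is constant. -/
theorem IsSAESol.wronskian_eq {B : ℝ → ℝ} (hB : Continuous B) {lam : ℂ} {s s' : ℝ}
    {c₁ c₂ d₁ d₂ : ℂ} {Φ φ Ψ ψ : ℝ → ℂ}
    (hΦ : IsSAESol B lam s c₁ c₂ Φ) (hφ : ∀ t, φ t = c₁ + ∫ u in s..t, Φ u)
    (hΨ : IsSAESol B lam s' d₁ d₂ Ψ) (hψ : ∀ t, ψ t = d₁ + ∫ u in s'..t, Ψ u) (x y : ℝ) :
    φ x * Ψ x - ψ x * Φ x = φ y * Ψ y - ψ y * Φ y := by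
  have hW (t : ℝ) : HasDerivAt (fun x => φ x * Ψ x - ψ x * Φ x) 0 t := by
    have hd := ((hΦ.hasDerivAt hφ t).mul (hΨ.hasDerivAt_quasiDeriv hB hψ t)).sub
      ((hΨ.hasDerivAt hψ t).mul (hΦ.hasDerivAt_quasiDeriv hB hφ t))
    refine (hd.congr_deriv (by ring)).congr_of_eventuallyEq (.of_forall fun x => ?_)
    simp only [Pi.mul_apply, Pi.sub_apply]
    ring
  exact is_const_of_deriv_eq_zero (fun t => (hW t).differentiableAt) (fun t => (hW t).deriv) x y

/-- Properties of the stochastic Airy kernel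
`𝔄_λ(t,u) = f_{λ,0}(t)·g_{λ,0}(u) − f_{λ,0}(u)·g_{λ,0}(t)`.
Here `F s` is the Dirichlet solution `f_{λ,s}` (data `(1,0)`), with derivative
`ΦF s = f'_{λ,s}`, and `G s` is the Neumann solution `g_{λ,s}` (data `(0,1)`),
with derivative `ΦG s = g'_{λ,s}`. -/
theorem stmt4 (B : ℝ → ℝ) (hB : Continuous B) (lam : ℂ)
    (F ΦF G ΦG : ℝ → ℝ → ℂ)
    (hΦF : ∀ s, IsSAESol B lam s 1 0 (ΦF s))
    (hF : ∀ s t, F s t = 1 + ∫ u in s..t, ΦF s u)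
    (hΦG : ∀ s, IsSAESol B lam s 0 1 (ΦG s))
    (hG : ∀ s t, G s t = ∫ u in s..t, ΦG s u) :
    ∀ t u : ℝ,
      (∀ s : ℝ, F 0 t * G 0 u - F 0 u * G 0 t = F s t * G s u - F s u * G s t) ∧
      (F 0 t * G 0 u - F 0 u * G 0 t = G t u) ∧
      (F 0 t * G 0 u - F 0 u * G 0 t = -(G u t)) ∧
      HasDerivAt (fun v : ℝ => F 0 t * G 0 v - F 0 v * G 0 t) (F u t) u ∧
      HasDerivAt (fun r : ℝ => F 0 r * G 0 u - F 0 u * G 0 r) (-(F t u)) t ∧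
      HasDerivAt (fun r : ℝ => F u r) (ΦF u t) t ∧
      ΦF u t = -(ΦF t u) := by
  have hG' (s t : ℝ) : G s t = 0 + ∫ u in s..t, ΦG s u := by rw [hG, zero_add]
  have F_base (s : ℝ) : F s s = 1 := by simp [hF]
  have G_base (s : ℝ) : G s s = 0 := by simp [hG]
  have ΦF_base (s : ℝ) : ΦF s s = 0 := (hΦF s).apply_base
  have ΦG_base (s : ℝ) : ΦG s s = 1 := (hΦG s).apply_base
  have F_deriv (s t : ℝ) : HasDerivAt (F s) (ΦF s t) t := (hΦF s).hasDerivAt (hF s) t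
  have G_deriv (s t : ℝ) : HasDerivAt (G s) (ΦG s t) t := (hΦG s).hasDerivAt (hG' s) t
  have wronskian_one (s x : ℝ) : F s x * ΦG s x - G s x * ΦF s x = 1 := by
    rw [(hΦF s).wronskian_eq hB (hF s) (hΦG s) (hG' s) x s]
    simp [F_base, G_base, ΦG_base]
  have base_change (s t u : ℝ) :
      F 0 t * G 0 u - F 0 u * G 0 t = F s t * G s u - F s u * G s t := by
    have hFx (x : ℝ) : F 0 x = F 0 s * F s x + ΦF 0 s * G s x := by
      have h₁ := (hΦF 0).wronskian_eq hB (hF 0) (hΦG s) (hG' s) x s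
      have h₂ := (hΦF s).wronskian_eq hB (hF s) (hΦF 0) (hF 0) x s
      simp only [F_base, G_base, ΦF_base, ΦG_base] at h₁ h₂
      linear_combination F s x * h₁ + G s x * h₂ - F 0 x * wronskian_one s x
    have hGx (x : ℝ) : G 0 x = G 0 s * F s x + ΦG 0 s * G s x := by
      have h₁ := (hΦG 0).wronskian_eq hB (hG' 0) (hΦG s) (hG' s) x s
      have h₂ := (hΦF s).wronskian_eq hB (hF s) (hΦG 0) (hG' 0) x s
      simp only [F_base, G_base, ΦF_base, ΦG_base] at h₁ h₂
      linear_combination F s x * h₁ + G s x * h₂ - G 0 x * wronskian_one s x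
    rw [hFx t, hFx u, hGx t, hGx u]
    linear_combination (F s t * G s u - F s u * G s t) * wronskian_one 0 s
  intro t u
  refine ⟨fun s => base_change s t u, ?_, ?_, ?_, ?_, F_deriv u t, ?_⟩
  · rw [base_change t t u, F_base, G_base]
    ring
  · rw [base_change u t u, F_base, G_base]
    ring
  · rw [funext fun v => base_change u t v]
    refine (((G_deriv u u).const_mul (F u t)).sub ((F_deriv u u).mul_const (G u t))).congr_deriv ?_
    rw [ΦF_base, ΦG_base]
    ring
  · rw [funext fun r => base_change t r u]
    refine (((F_deriv t t).mul_const (G t u)).sub ((G_deriv t t).const_mul (F t u))).congr_deriv ?_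
    rw [ΦF_base, ΦG_base]
    ring
  · have h := (hΦF t).wronskian_eq hB (hF t) (hΦF u) (hF u) t u
    simp only [F_base, ΦF_base] at h
    linear_combination h
end

section
/- Let B : ℝ → ℝ be continuous, s ∈ ℝ, and λ ∈ ℂ with Im λ ≠ 0. Let φ be the C¹ solution of the stochastic Airy equation based at s with data (c₁, c₂) ∈ ℂ², (c₁, c₂) ≠ (0, 0). Then φ has at most one zero on ℝ. Moreover, if (c₁, c₂) ∈ ℝ² and c₁ ≠ 0, then φ(t) ≠ 0 for all t ∈ ℝ, and φ'(t) ≠ 0 for all t ∈ ℝ with t ≠ s. -/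
open MeasureTheory Filter Topology Set

/-- A solution of a continuous linear ODE which vanishes at one time vanishes identically. -/
theorem eq_zero_of_hasDerivAt_clm {E : Type*} [NormedAddCommGroup E] [NormedSpace ℝ E]
    {A : ℝ → E →L[ℝ] E} (hA : Continuous A) {f : ℝ → E}
    (hf : ∀ t, HasDerivAt f (A t (f t)) t) {t₀ : ℝ} (h₀ : f t₀ = 0) (t : ℝ) : f t = 0 := by
  set a := min t t₀ - 1
  set b := max t t₀ + 1
  have ht : t ∈ Ioo a b := by grind
  have ht₀ : t₀ ∈ Ioo a b := by grind
  obtain ⟨C, hC⟩ := (isCompact_Icc (a := a) (b := b)).exists_bound_of_continuousOn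
    hA.continuousOn
  refine ODE_solution_unique_of_mem_Ioo (v := fun t => A t) (s := fun _ => univ)
    (g := fun _ => 0) (K := C.toNNReal) (fun u hu => ?_) ht₀ (fun u _ => ⟨hf u, trivial⟩)
    (fun u _ => ⟨by simpa using hasDerivAt_const u (0 : E), trivial⟩) h₀ ht
  refine ((A u).lipschitz.weaken ?_).lipschitzOnWith
  rw [← NNReal.coe_le_coe, coe_nnnorm]
  exact (hC u (Ioo_subset_Icc_self hu)).trans (Real.le_coe_toNNReal C)

/-- The first-order system satisfied by a solution `φ` and its regularised derivative
`Φ - (t² / 2 + B) φ`. -/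
theorem IsSAESol.exists_system {B : ℝ → ℝ} (hB : Continuous B) {lam : ℂ} {s : ℝ} {c₁ c₂ : ℂ}
    {Φ φ : ℝ → ℂ} (hΦ : IsSAESol B lam s c₁ c₂ Φ) (hφ : ∀ t, φ t = c₁ + ∫ u in s..t, Φ u) :
    ∃ χ : ℝ → ℂ, (∀ t, Φ t = χ t + ((t ^ 2 / 2 + B t : ℝ) : ℂ) * φ t) ∧
      (∀ t, HasDerivAt φ (Φ t) t) ∧
      ∀ t, HasDerivAt χ (lam * φ t - ((t ^ 2 / 2 + B t : ℝ) : ℂ) * Φ t) t := by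
  obtain ⟨hcont, heq⟩ := hΦ
  set a : ℝ → ℂ := fun t => ((t ^ 2 / 2 + B t : ℝ) : ℂ) + lam * t with ha
  have ha_cont : Continuous a := by fun_prop
  have hcontm : Continuous fun u => a u * Φ u := ha_cont.mul hcont
  have hderiv (t : ℝ) : HasDerivAt φ (Φ t) t := by
    rw [funext hφ]
    exact (hcont.integral_hasStrictDerivAt s t).hasDerivAt.const_add c₁
  have hker (t u : ℝ) : Uker B lam t u = a t - a u := by
    simp only [Uker, ha]
    push_cast
    ring
  refine ⟨fun t => c₂ - c₁ * a s + lam * t * φ t - ∫ u in s..t, a u * Φ u, fun t => ?_, hderiv,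
    fun t => ?_⟩
  · have hint : ∫ u in s..t, Uker B lam t u * Φ u
        = a t * (∫ u in s..t, Φ u) - ∫ u in s..t, a u * Φ u := by
      simp_rw [hker, sub_mul]
      rw [intervalIntegral.integral_sub ((hcont.const_mul _).intervalIntegrable _ _)
        (hcontm.intervalIntegrable _ _), intervalIntegral.integral_const_mul]
    rw [heq t, hint, hker, eq_sub_of_add_eq' (hφ t).symm]
    simp only [ha]
    ring
  · have hid : HasDerivAt (fun t : ℝ => lam * (t : ℂ)) (lam * 1) t :=
      ((hasDerivAt_id t).ofReal_comp).const_mul lam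
    have h := ((hid.mul (hderiv t)).const_add (c₂ - c₁ * a s)).sub
      (hcontm.integral_hasStrictDerivAt s t).hasDerivAt
    refine h.congr_deriv ?_
    simp only [ha]
    ring

/-- The Wronskian of `φ` and its conjugate, scaled by `Im λ`, is strictly increasing. -/
theorem IsSAESol.strictMono_wronskian {B : ℝ → ℝ} (hB : Continuous B) {lam : ℂ}
    (hlam : lam.im ≠ 0) {s : ℝ} {c₁ c₂ : ℂ} (hc : ¬(c₁ = 0 ∧ c₂ = 0))
    {Φ φ : ℝ → ℂ} (hΦ : IsSAESol B lam s c₁ c₂ Φ) (hφ : ∀ t, φ t = c₁ + ∫ u in s..t, Φ u) :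
    StrictMono fun t => lam.im * ((φ t).re * (Φ t).im - (φ t).im * (Φ t).re) := by
  obtain ⟨χ, hχ, hφ', hχ'⟩ := hΦ.exists_system hB hφ
  have hne (t : ℝ) : ¬(φ t = 0 ∧ Φ t = 0) := by
    rintro ⟨h1, h2⟩
    let A : ℝ → ℂ × ℂ →L[ℝ] ℂ × ℂ := fun t =>
      (t ^ 2 / 2 + B t) • (ContinuousLinearMap.fst ℝ ℂ ℂ).prod (-ContinuousLinearMap.snd ℝ ℂ ℂ)
        + (ContinuousLinearMap.snd ℝ ℂ ℂ).prod (lam • ContinuousLinearMap.fst ℝ ℂ ℂ)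
        - (t ^ 2 / 2 + B t) ^ 2 •
          (0 : ℂ × ℂ →L[ℝ] ℂ).prod (ContinuousLinearMap.fst ℝ ℂ ℂ)
    have hA : Continuous A := by fun_prop
    have h0 (u : ℝ) : (φ u, χ u) = 0 := by
      refine eq_zero_of_hasDerivAt_clm hA (f := fun u => (φ u, χ u)) (fun u => ?_) (t₀ := t) ?_ u
      · refine ((hφ' u).prodMk (hχ' u)).congr_deriv ?_
        rw [hχ u]
        ext1
        · simp [A]
          ring
        · simp [A]
          ring
      · have h3 := hχ t
        rw [h1, h2, mul_zero, add_zero] at h3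
        simp [h1, ← h3]
    have h4 : φ s = 0 := congrArg Prod.fst (h0 s)
    have h5 : χ s = 0 := congrArg Prod.snd (h0 s)
    refine hc ⟨by simpa [hφ s] using h4, ?_⟩
    have h6 := hχ s
    rw [h4, h5, hΦ.2 s] at h6
    simpa [Uker] using h6
  have hW (t : ℝ) :
      HasDerivAt (fun t => lam.im * ((φ t).re * (Φ t).im - (φ t).im * (Φ t).re))
        (lam.im ^ 2 * Complex.normSq (φ t)) t := by
    have hrw : (fun t => lam.im * ((φ t).re * (Φ t).im - (φ t).im * (Φ t).re))
        = fun t => lam.im * ((φ t).re * (χ t).im - (φ t).im * (χ t).re) := by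
      funext u
      rw [hχ u]
      simp only [Complex.add_re, Complex.add_im, Complex.re_ofReal_mul, Complex.im_ofReal_mul]
      ring
    have hre {f : ℝ → ℂ} {f' : ℂ} (h : HasDerivAt f f' t) :
        HasDerivAt (fun t => (f t).re) f'.re t :=
      Complex.reCLM.hasFDerivAt.comp_hasDerivAt t h
    have him {f : ℝ → ℂ} {f' : ℂ} (h : HasDerivAt f f' t) :
        HasDerivAt (fun t => (f t).im) f'.im t :=
      Complex.imCLM.hasFDerivAt.comp_hasDerivAt t h
    rw [hrw]
    refine ((((hre (hφ' t)).mul (him (hχ' t))).sub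
      ((him (hφ' t)).mul (hre (hχ' t)))).const_mul lam.im).congr_deriv ?_
    rw [hχ t]
    simp only [Complex.add_re, Complex.add_im, Complex.sub_re, Complex.sub_im, Complex.mul_re,
      Complex.mul_im, Complex.ofReal_re, Complex.ofReal_im, Complex.normSq_apply]
    ring
  have hmono : Monotone fun t => lam.im * ((φ t).re * (Φ t).im - (φ t).im * (Φ t).re) :=
    monotone_of_deriv_nonneg (fun t => (hW t).differentiableAt) fun t => by
      rw [(hW t).deriv]
      exact mul_nonneg (sq_nonneg _) (Complex.normSq_nonneg _)
  refine hmono.strictMono_of_injective ?_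
  have key {x y : ℝ} (hxy : x < y) :
      lam.im * ((φ x).re * (Φ x).im - (φ x).im * (Φ x).re)
        ≠ lam.im * ((φ y).re * (Φ y).im - (φ y).im * (Φ y).re) := by
    intro h
    have hzero {u : ℝ} (hu : u ∈ Ioo x y) : φ u = 0 := by
      have hev : (fun t => lam.im * ((φ t).re * (Φ t).im - (φ t).im * (Φ t).re)) =ᶠ[𝓝 u]
          fun _ => lam.im * ((φ x).re * (Φ x).im - (φ x).im * (Φ x).re) := by
        filter_upwards [Ioo_mem_nhds hu.1 hu.2] with v hv
        exact le_antisymm ((hmono hv.2.le).trans h.ge) (hmono hv.1.le)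
      have h1 := (hW u).unique ((hasDerivAt_const u _).congr_of_eventuallyEq hev)
      simpa [hlam] using h1
    obtain ⟨m, hm⟩ := nonempty_Ioo.2 hxy
    have hev : φ =ᶠ[𝓝 m] fun _ => 0 := by
      filter_upwards [Ioo_mem_nhds hm.1 hm.2] with v hv using hzero hv
    exact hne m ⟨hzero hm, (hφ' m).unique ((hasDerivAt_const m _).congr_of_eventuallyEq hev)⟩
  intro x y h
  rcases lt_trichotomy x y with hxy | hxy | hxy
  · exact absurd h (key hxy)
  · exact hxy
  · exact absurd h.symm (key hxy)

/-- For `Im λ ≠ 0`, a nontrivial solution of the stochastic Airy equation has at most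
one zero; if moreover the data is real with `c₁ ≠ 0`, it has no zero at all and its
derivative does not vanish away from the base point. -/
theorem stmt6 (B : ℝ → ℝ) (hB : Continuous B) (lam : ℂ) (hlam : lam.im ≠ 0)
    (s : ℝ) (c₁ c₂ : ℂ) (hc : ¬(c₁ = 0 ∧ c₂ = 0))
    (Φ φ : ℝ → ℂ) (hΦ : IsSAESol B lam s c₁ c₂ Φ)
    (hφ : ∀ t : ℝ, φ t = c₁ + ∫ u in s..t, Φ u) :
    {t : ℝ | φ t = 0}.Subsingleton ∧
    (c₁.im = 0 → c₂.im = 0 → c₁ ≠ 0 →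
      (∀ t : ℝ, φ t ≠ 0) ∧ (∀ t : ℝ, t ≠ s → Φ t ≠ 0)) := by
  have hW := (hΦ.strictMono_wronskian hB hlam hc hφ).injective
  refine ⟨fun x hx y hy => hW ?_, fun h1 h2 h3 => ?_⟩
  · simp only [mem_ofPred_eq] at hx hy
    simp [hx, hy]
  · have hφs : φ s = c₁ := by simp [hφ s]
    have hΦs : Φ s = c₂ := by simp [hΦ.2 s, Uker]
    have hne {t : ℝ} (ht : t ≠ s) : (φ t).re * (Φ t).im - (φ t).im * (Φ t).re ≠ 0 :=
      fun h => ht (hW (by simp [h, hφs, hΦs, h1, h2]))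
    refine ⟨fun t h => ?_, fun t ht h => hne ht (by simp [h])⟩
    rcases eq_or_ne t s with rfl | ht
    · exact h3 (hφs ▸ h)
    · exact hne ht (by simp [h])
end

section
/- Let φ ∈ C¹([0,∞), ℝ) with φ(0) > 0, and suppose every zero of φ is simple, i.e. φ'(𝔷) ≠ 0 whenever φ(𝔷) = 0. Then the zero set of φ is locally finite; write N_t for the (finite) number of zeros of φ in [0,t). The function ρ = φ'/φ extends to a continuous map from [0,∞) to the one-point compactification ℝ ∪ {∞}. Moreover, for every t ≥ 0 with φ(t) ≠ 0, the principal value pv∫_0^t ρ(u) du := lim_{ε→0⁺} ∫_{S_{t,ε}} ρ(u) du exists in ℝ, where S_{t,ε} = [0,t] minus the union of the intervals [𝔷 − ε, 𝔷 + ε] over the zeros 𝔷 of φ in [0,t), and one has φ(t) = φ(0)·(−1)^{N_t}·exp( pv∫_0^t ρ(u) du ). -/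
open MeasureTheory Filter Topology Set

/-- The zeros of `φ` in `[0, t)`. -/
abbrev zerosBefore (φ : ℝ → ℝ) (t : ℝ) : Set ℝ := {z : ℝ | 0 ≤ z ∧ z < t ∧ φ z = 0}

/-- `[0, t]` with the closed `ε`-neighbourhoods of the zeros of `φ` in `[0, t)` removed. -/
abbrev excisedInterval (φ : ℝ → ℝ) (t ε : ℝ) : Set ℝ :=
  Set.Icc 0 t \ (⋃ z ∈ zerosBefore φ t, Set.Icc (z - ε) (z + ε))

lemma finite_zeros_Icc {φ φ' : ℝ → ℝ}
    (hderiv : ∀ t ∈ Set.Ici (0 : ℝ), HasDerivWithinAt φ (φ' t) (Set.Ici 0) t)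
    (hsimple : ∀ t ∈ Set.Ici (0 : ℝ), φ t = 0 → φ' t ≠ 0) (T : ℝ) :
    {t : ℝ | 0 ≤ t ∧ t ≤ T ∧ φ t = 0}.Finite := by
  by_contra hinf
  obtain ⟨x, hxT, hx⟩ := Set.Infinite.exists_accPt_of_subset_isCompact hinf
    (isCompact_Icc (a := (0 : ℝ)) (b := T)) (fun u hu => ⟨hu.1, hu.2.1⟩)
  rw [accPt_iff_frequently] at hx
  have hcx : ContinuousWithinAt φ (Set.Ici 0) x := (hderiv x hxT.1).continuousWithinAt
  have hzero : φ x = 0 := by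
    by_contra hne
    have h := hcx.eventually_ne hne
    rw [eventually_nhdsWithin_iff] at h
    obtain ⟨y, ⟨-, hy⟩, hy'⟩ := (hx.and_eventually h).exists
    exact hy' hy.1 hy.2.2
  have h := (hderiv x hxT.1).eventually_ne (c := 0) (hsimple x hxT.1 hzero)
  rw [eventually_nhdsWithin_iff] at h
  obtain ⟨y, ⟨hyx, hy⟩, hy'⟩ := (hx.and_eventually h).exists
  exact hy' ⟨hy.1, hyx⟩ hy.2.2

lemma exists_continuousOn_onePoint_logDeriv {φ φ' : ℝ → ℝ}
    (hφ : ContinuousOn φ (Set.Ici 0)) (hcont : ContinuousOn φ' (Set.Ici 0))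
    (hsimple : ∀ t ∈ Set.Ici (0 : ℝ), φ t = 0 → φ' t ≠ 0) :
    ∃ ρc : ℝ → OnePoint ℝ, ContinuousOn ρc (Set.Ici 0) ∧
      (∀ t ∈ Set.Ici (0 : ℝ), φ t ≠ 0 → ρc t = OnePoint.some (φ' t / φ t)) ∧
      (∀ t ∈ Set.Ici (0 : ℝ), φ t = 0 → ρc t = OnePoint.infty) := by
  classical
  refine ⟨fun t => if φ t = 0 then OnePoint.infty else OnePoint.some (φ' t / φ t), ?_,
    fun t _ h => if_neg h, fun t _ h => if_pos h⟩
  intro x hx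
  by_cases h : φ x = 0
  · have h1 : Tendsto φ (𝓝[Set.Ici 0 ∩ {y | φ y ≠ 0}] x) (𝓝[≠] 0) := by
      refine tendsto_nhdsWithin_iff.2 ⟨?_, ?_⟩
      · have := (hφ x hx).mono_left (nhdsWithin_mono x (Set.inter_subset_left (t := {y | φ y ≠ 0})))
        rwa [h] at this
      · filter_upwards [self_mem_nhdsWithin] with y hy using hy.2
    have h2 : Tendsto (fun y => φ' y / φ y) (𝓝[Set.Ici 0 ∩ {y | φ y ≠ 0}] x) (cocompact ℝ) := by
      rw [← Metric.cobounded_eq_cocompact, ← tendsto_norm_atTop_iff_cobounded]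
      have h3 := tendsto_norm_atTop_iff_cobounded.2 (tendsto_inv₀_nhdsNE_zero.comp h1)
      have h4 := ((hcont x hx).mono_left
        (nhdsWithin_mono x (Set.inter_subset_left (t := {y | φ y ≠ 0})))).norm
      refine (h4.pos_mul_atTop (norm_pos_iff.2 (hsimple x hx h)) h3).congr fun y => ?_
      simp [div_eq_mul_inv]
    have h5 : Tendsto (fun y => (OnePoint.some (φ' y / φ y) : OnePoint ℝ))
        (𝓝[Set.Ici 0 ∩ {y | φ y ≠ 0}] x) (𝓝 OnePoint.infty) :=
      (OnePoint.tendsto_coe_infty.mono_left (by rw [coclosedCompact_eq_cocompact])).comp h2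
    simp only [ContinuousWithinAt, h, if_true]
    refine Tendsto.if ?_ ?_
    · exact tendsto_const_nhds
    · refine h5.mono_left ?_
      rw [nhdsWithin_inter']
  · have h1 : ContinuousWithinAt (fun y => (OnePoint.some (φ' y / φ y) : OnePoint ℝ))
        (Set.Ici 0) x :=
      OnePoint.continuous_coe.continuousAt.comp_continuousWithinAt ((hcont x hx).div (hφ x hx) h)
    refine h1.congr_of_eventuallyEq ?_ (if_neg h)
    filter_upwards [(hφ x hx).eventually_ne h] with y hy using if_neg hy

lemma integrableOn_logDeriv_Icc {φ φ' : ℝ → ℝ} (hφ : ContinuousOn φ (Set.Ici 0))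
    (hcont : ContinuousOn φ' (Set.Ici 0)) {a b : ℝ} (ha : 0 ≤ a)
    (hne : ∀ u ∈ Set.Icc a b, φ u ≠ 0) :
    IntegrableOn (fun u => φ' u / φ u) (Set.Icc a b) :=
  have hsub : Set.Icc a b ⊆ Set.Ici 0 := fun _ hu => ha.trans hu.1
  ((hcont.mono hsub).div (hφ.mono hsub) hne).integrableOn_Icc

lemma setIntegral_Icc_logDeriv {φ φ' : ℝ → ℝ}
    (hderiv : ∀ t ∈ Set.Ici (0 : ℝ), HasDerivWithinAt φ (φ' t) (Set.Ici 0) t)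
    (hcont : ContinuousOn φ' (Set.Ici 0)) {a b : ℝ} (ha : 0 ≤ a) (hab : a ≤ b)
    (hne : ∀ u ∈ Set.Icc a b, φ u ≠ 0) :
    ∫ u in Set.Icc a b, φ' u / φ u = Real.log (φ b) - Real.log (φ a) := by
  have hφ : ContinuousOn φ (Set.Ici 0) := fun u hu => (hderiv u hu).continuousWithinAt
  have hsub : Set.Icc a b ⊆ Set.Ici 0 := fun _ hu => ha.trans hu.1
  rw [integral_Icc_eq_integral_Ioc, ← intervalIntegral.integral_of_le hab]
  refine intervalIntegral.integral_eq_sub_of_hasDerivAt_of_le (f := fun u => Real.log (φ u)) hab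
    ((hφ.mono hsub).log hne) (fun u hu => ?_) ?_
  · exact ((hderiv u (ha.trans hu.1.le)).hasDerivAt (Ici_mem_nhds (ha.trans_lt hu.1))).log
      (hne u ⟨hu.1.le, hu.2.le⟩)
  · rw [intervalIntegrable_iff_integrableOn_Icc_of_le hab]
    exact integrableOn_logDeriv_Icc hφ hcont ha hne

lemma ContinuousOn.mul_pos_of_ne_zero_Icc {f : ℝ → ℝ} {a b : ℝ} (hab : a ≤ b)
    (hf : ContinuousOn f (Set.Icc a b)) (hne : ∀ u ∈ Set.Icc a b, f u ≠ 0) :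
    0 < f a * f b := by
  by_contra hle
  have ha := hne a ⟨le_rfl, hab⟩
  have hb := hne b ⟨hab, le_rfl⟩
  have hneg : f a * f b < 0 := lt_of_le_of_ne (not_lt.1 hle) (mul_ne_zero ha hb)
  rcases mul_neg_iff.1 hneg with h | h
  · obtain ⟨u, hu, hu0⟩ := intermediate_value_Icc' hab hf ⟨h.2.le, h.1.le⟩
    exact hne u hu hu0
  · obtain ⟨u, hu, hu0⟩ := intermediate_value_Icc hab hf ⟨h.1.le, h.2.le⟩
    exact hne u hu hu0

lemma HasDerivAt.tendsto_div_reflection {f : ℝ → ℝ} {f' z : ℝ} (hf : HasDerivAt f f' z)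
    (hz : f z = 0) (hf' : f' ≠ 0) :
    Tendsto (fun ε => f (z - ε) / f (z + ε)) (𝓝[>] 0) (𝓝 (-1)) := by
  have hR : Tendsto (fun ε : ℝ => ε⁻¹ * f (z + ε)) (𝓝[>] 0) (𝓝 f') := by
    simpa [hz] using hf.tendsto_slope_zero_right
  have hL : Tendsto (fun ε : ℝ => -(ε⁻¹ * f (z - ε))) (𝓝[>] 0) (𝓝 f') := by
    have hneg : Tendsto (fun ε : ℝ => -ε) (𝓝[>] 0) (𝓝[<] 0) := by
      simpa using tendsto_neg_nhdsGT_neg (a := (0 : ℝ))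
    refine (hf.tendsto_slope_zero_left.comp hneg).congr fun ε => ?_
    simp [hz, sub_eq_add_neg, inv_neg]
  have h := hL.neg.div hR hf'
  rw [neg_div, div_self hf'] at h
  refine h.congr' ?_
  filter_upwards [self_mem_nhdsWithin] with ε hε
  have hε0 : ε ≠ 0 := ne_of_gt hε
  rw [Pi.div_apply, neg_neg, mul_div_mul_left _ _ (inv_ne_zero hε0)]

lemma measurableSet_excisedInterval {φ : ℝ → ℝ} {t : ℝ} (hfin : (zerosBefore φ t).Finite) (ε : ℝ) :
    MeasurableSet (excisedInterval φ t ε) :=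
  measurableSet_Icc.diff (hfin.measurableSet_biUnion fun _ _ => measurableSet_Icc)

lemma excisedInterval_eq_union {φ : ℝ → ℝ} {s z t ε : ℝ} (hs : 0 ≤ s) (hzt : z < t)
    (hZ : zerosBefore φ t = insert z (zerosBefore φ s)) (hε : 0 < ε) (hεs : ε < z - s)
    (hεw : ∀ w ∈ zerosBefore φ s, w + ε < s) :
    excisedInterval φ t ε =
      excisedInterval φ s ε ∪ (Set.Ioo s (z - ε) ∪ Set.Ioc (z + ε) t) := by
  rw [excisedInterval, hZ, Set.biUnion_insert]
  ext u
  simp only [Set.mem_sdiff, Set.mem_union, Set.mem_iUnion, Set.mem_Icc, Set.mem_Ioo, Set.mem_Ioc,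
    not_or, not_exists, not_and, not_le, exists_prop]
  constructor
  · rintro ⟨⟨h0, ht⟩, hz, hw⟩
    rcases le_or_gt u s with hus | hus
    · exact Or.inl ⟨⟨h0, hus⟩, hw⟩
    · rcases lt_or_ge u (z - ε) with h | h
      · exact Or.inr (Or.inl ⟨hus, h⟩)
      · exact Or.inr (Or.inr ⟨hz h, ht⟩)
  · rintro (⟨⟨h0, hus⟩, hw⟩ | ⟨hus, huz⟩ | ⟨huz, hut⟩)
    · exact ⟨⟨h0, by linarith⟩, fun h => by linarith, hw⟩
    · exact ⟨⟨by linarith, by linarith⟩, fun h => by linarith, fun w hw _ => by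
        linarith [hεw w hw]⟩
    · exact ⟨⟨by linarith, hut⟩, fun _ => huz, fun w hw _ => by linarith [hεw w hw]⟩

/-- The principal value of `∫ φ'/φ` over `[0, t]` is `log |φ t| - log |φ 0|`, and `φ` changes sign
at each of its zeros. -/
lemma pv_logDeriv_and_sign {φ φ' : ℝ → ℝ}
    (hderiv : ∀ t ∈ Set.Ici (0 : ℝ), HasDerivWithinAt φ (φ' t) (Set.Ici 0) t)
    (hcont : ContinuousOn φ' (Set.Ici 0)) (h0 : 0 < φ 0)
    (hsimple : ∀ t ∈ Set.Ici (0 : ℝ), φ t = 0 → φ' t ≠ 0) (n : ℕ) :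
    ∀ t : ℝ, 0 ≤ t → φ t ≠ 0 → (zerosBefore φ t).ncard = n →
      (∀ᶠ ε in 𝓝[>] (0 : ℝ), IntegrableOn (fun u => φ' u / φ u) (excisedInterval φ t ε)) ∧
      Tendsto (fun ε : ℝ => ∫ u in excisedInterval φ t ε, φ' u / φ u) (𝓝[>] 0)
        (𝓝 (Real.log (φ t) - Real.log (φ 0))) ∧
      0 < (-1 : ℝ) ^ n * φ t := by
  have hφ : ContinuousOn φ (Set.Ici 0) := fun u hu => (hderiv u hu).continuousWithinAt
  have hfin : ∀ t, (zerosBefore φ t).Finite := fun t =>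
    (finite_zeros_Icc hderiv hsimple t).subset fun u hu => ⟨hu.1, hu.2.1.le, hu.2.2⟩
  induction n with
  | zero =>
    intro t ht hφt hn
    rw [Set.ncard_eq_zero (hfin t)] at hn
    have hne : ∀ u ∈ Set.Icc 0 t, φ u ≠ 0 := by
      intro u hu hu0
      have hut : u < t := lt_of_le_of_ne hu.2 (by rintro rfl; exact hφt hu0)
      exact (Set.eq_empty_iff_forall_notMem.1 hn u) ⟨hu.1, hut, hu0⟩
    have hS : ∀ ε, excisedInterval φ t ε = Set.Icc 0 t := fun ε => by simp [excisedInterval, hn]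
    simp only [hS]
    refine ⟨Eventually.of_forall fun _ => integrableOn_logDeriv_Icc hφ hcont le_rfl hne, ?_, ?_⟩
    · rw [setIntegral_Icc_logDeriv hderiv hcont le_rfl ht hne]
      exact tendsto_const_nhds
    · have := ContinuousOn.mul_pos_of_ne_zero_Icc ht (hφ.mono fun u hu => hu.1) hne
      simpa using (mul_pos_iff_of_pos_left h0).1 this
  | succ n ih =>
    intro t ht hφt hn
    have hnonempty : (zerosBefore φ t).Nonempty := by
      rw [← Set.ncard_pos (hfin t)]; omega
    obtain ⟨z, hz, hmax⟩ := Set.exists_max_image _ id (hfin t) hnonempty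
    simp only [id] at hmax
    have hz0 : 0 < z := lt_of_le_of_ne hz.1 (by rintro rfl; exact h0.ne' hz.2.2)
    have hzt : z < t := hz.2.1
    obtain ⟨s, ⟨hs0, hsw⟩, hsz⟩ : ∃ s, (0 < s ∧ ∀ w ∈ zerosBefore φ t \ {z}, w < s) ∧ s < z := by
      have h1 : ∀ᶠ s in 𝓝[<] z, ∀ w ∈ zerosBefore φ t \ {z}, w < s :=
        (hfin t).sdiff.eventually_all.2 fun w hw =>
          nhdsWithin_le_nhds (lt_mem_nhds (lt_of_le_of_ne (hmax w hw.1) hw.2))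
      have h2 : ∀ᶠ s in 𝓝[<] z, 0 < s := nhdsWithin_le_nhds (lt_mem_nhds hz0)
      exact ((h2.and h1).and self_mem_nhdsWithin).exists
    have hZ : zerosBefore φ t = insert z (zerosBefore φ s) := by
      ext u
      constructor
      · intro hu
        by_cases huz : u = z
        · exact Or.inl huz
        · exact Or.inr ⟨hu.1, hsw u ⟨hu, huz⟩, hu.2.2⟩
      · rintro (rfl | hu)
        · exact hz
        · exact ⟨hu.1, by linarith [hu.2.1], hu.2.2⟩
    have hzs : z ∉ zerosBefore φ s := fun h => by linarith [h.2.1]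
    have hns : (zerosBefore φ s).ncard = n := by
      rw [hZ, Set.ncard_insert_of_notMem hzs (hfin s)] at hn
      omega
    have hne : ∀ u, s ≤ u → u ≤ t → u ≠ z → φ u ≠ 0 := by
      intro u hsu hut huz hu0
      have hut' : u < t := lt_of_le_of_ne hut (by rintro rfl; exact hφt hu0)
      linarith [hsw u ⟨⟨hs0.le.trans hsu, hut', hu0⟩, huz⟩]
    obtain ⟨ihI, ihT, ihS⟩ := ih s hs0.le (hne s le_rfl (by linarith) hsz.ne) hns
    have hratio := HasDerivAt.tendsto_div_reflection
      ((hderiv z hz.1).hasDerivAt (Ici_mem_nhds hz0)) hz.2.2 (hsimple z hz.1 hz.2.2)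
    have hsmall : ∀ᶠ ε in 𝓝[>] (0 : ℝ), 0 < ε ∧ ε < z - s ∧ ε < t - z ∧
        ∀ w ∈ zerosBefore φ s, w + ε < s := by
      have h1 : ∀ᶠ ε in 𝓝[>] (0 : ℝ), ∀ w ∈ zerosBefore φ s, ε < s - w :=
        (hfin s).eventually_all.2 fun w hw =>
          nhdsWithin_le_nhds (gt_mem_nhds (sub_pos.2 hw.2.1))
      filter_upwards [self_mem_nhdsWithin, nhdsWithin_le_nhds (gt_mem_nhds (sub_pos.2 hsz)),
        nhdsWithin_le_nhds (gt_mem_nhds (sub_pos.2 hzt)), h1] with ε ha hb hc hd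
      exact ⟨ha, hb, hc, fun w hw => by linarith [hd w hw]⟩
    have hneL : ∀ ε, 0 < ε → ∀ u ∈ Set.Icc s (z - ε), φ u ≠ 0 := fun ε hε u hu =>
      hne u hu.1 (by linarith [hu.2]) (by linarith [hu.2] : u < z).ne
    have hneR : ∀ ε, 0 < ε → ∀ u ∈ Set.Icc (z + ε) t, φ u ≠ 0 := fun ε hε u hu =>
      hne u (by linarith [hu.1]) hu.2 (by linarith [hu.1] : z < u).ne'
    have hsplit : ∀ᶠ ε in 𝓝[>] (0 : ℝ),
        IntegrableOn (fun u => φ' u / φ u) (excisedInterval φ t ε) ∧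
        ∫ u in excisedInterval φ t ε, φ' u / φ u =
          (∫ u in excisedInterval φ s ε, φ' u / φ u) +
            (Real.log (φ (z - ε) / φ (z + ε)) + Real.log (φ t) - Real.log (φ s)) := by
      filter_upwards [ihI, hsmall] with ε hI ⟨hε, hεs, hεt, hεw⟩
      have hL := hneL ε hε
      have hR := hneR ε hε
      have hIL : IntegrableOn (fun u => φ' u / φ u) (Set.Ioo s (z - ε)) :=
        (integrableOn_logDeriv_Icc hφ hcont hs0.le hL).mono_set Set.Ioo_subset_Icc_self
      have hIR : IntegrableOn (fun u => φ' u / φ u) (Set.Ioc (z + ε) t) :=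
        (integrableOn_logDeriv_Icc hφ hcont (by linarith) hR).mono_set Set.Ioc_subset_Icc_self
      rw [excisedInterval_eq_union hs0.le hzt hZ hε hεs hεw]
      refine ⟨hI.union (hIL.union hIR), ?_⟩
      rw [setIntegral_union _ (measurableSet_Ioo.union measurableSet_Ioc) hI (hIL.union hIR),
        setIntegral_union _ measurableSet_Ioc hIL hIR, ← integral_Icc_eq_integral_Ioo,
        ← integral_Icc_eq_integral_Ioc,
        setIntegral_Icc_logDeriv hderiv hcont hs0.le (by linarith) hL,
        setIntegral_Icc_logDeriv hderiv hcont (by linarith) (by linarith) hR,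
        Real.log_div (hL _ ⟨by linarith, le_rfl⟩) (hR _ ⟨le_rfl, by linarith⟩)]
      · ring
      · exact Set.disjoint_left.2 fun u hu hu' => by linarith [hu.2, hu'.1]
      · refine Set.disjoint_left.2 fun u hu hu' => ?_
        rcases hu' with hu' | hu'
        · linarith [hu.1.2, hu'.1]
        · linarith [hu.1.2, hu'.1]
    refine ⟨hsplit.mono fun ε h => h.1, ?_, ?_⟩
    · have hlog : Tendsto (fun ε => Real.log (φ (z - ε) / φ (z + ε))) (𝓝[>] 0) (𝓝 0) := by
        simpa using hratio.log (by norm_num)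
      have h := ihT.add ((hlog.add_const (Real.log (φ t))).sub_const (Real.log (φ s)))
      rw [show Real.log (φ s) - Real.log (φ 0) + (0 + Real.log (φ t) - Real.log (φ s)) =
        Real.log (φ t) - Real.log (φ 0) by ring] at h
      exact h.congr' (hsplit.mono fun ε h => h.2.symm)
    · obtain ⟨ε, ⟨hε, hεs, hεt, -⟩, hneg⟩ :=
        (hsmall.and (hratio.eventually (gt_mem_nhds (by norm_num : (-1 : ℝ) < 0)))).exists
      have hL := ContinuousOn.mul_pos_of_ne_zero_Icc (by linarith)
        (hφ.mono fun u hu => hs0.le.trans hu.1) (hneL ε hε)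
      have hR := ContinuousOn.mul_pos_of_ne_zero_Icc (by linarith)
        (hφ.mono fun u hu => (by linarith : (0 : ℝ) ≤ z + ε).trans hu.1) (hneR ε hε)
      have hst : φ s * φ t < 0 := by
        rcases div_neg_iff.1 hneg with ⟨ha, hb⟩ | ⟨ha, hb⟩
        · exact mul_neg_of_pos_of_neg ((mul_pos_iff_of_pos_right ha).1 hL) (by nlinarith)
        · exact mul_neg_of_neg_of_pos (by nlinarith) ((mul_pos_iff_of_pos_left hb).1 hR)
      rw [pow_succ]
      rcases mul_neg_iff.1 hst with ⟨ha, hb⟩ | ⟨ha, hb⟩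
      · have := (mul_pos_iff_of_pos_right ha).1 ihS
        nlinarith
      · have : (-1 : ℝ) ^ n < 0 := by
          by_contra hc
          nlinarith [not_lt.1 hc]
        nlinarith

/-- Logarithmic-derivative representation of a C¹ function on `[0,∞)` with only
simple zeros: local finiteness of the zero set, continuous extension of
`ρ = φ'/φ` to the one-point compactification of `ℝ`, and the principal-value
formula `φ(t) = φ(0)·(−1)^{N_t}·exp(pv ∫_0^t ρ)`. -/
theorem stmt7 (φ φ' : ℝ → ℝ)
    (hderiv : ∀ t ∈ Set.Ici (0 : ℝ), HasDerivWithinAt φ (φ' t) (Set.Ici 0) t)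
    (hcont : ContinuousOn φ' (Set.Ici 0))
    (h0 : 0 < φ 0)
    (hsimple : ∀ t ∈ Set.Ici (0 : ℝ), φ t = 0 → φ' t ≠ 0) :
    (∀ T : ℝ, {t : ℝ | 0 ≤ t ∧ t ≤ T ∧ φ t = 0}.Finite) ∧
    (∃ ρc : ℝ → OnePoint ℝ, ContinuousOn ρc (Set.Ici 0) ∧
      (∀ t ∈ Set.Ici (0 : ℝ), φ t ≠ 0 → ρc t = OnePoint.some (φ' t / φ t)) ∧
      (∀ t ∈ Set.Ici (0 : ℝ), φ t = 0 → ρc t = OnePoint.infty)) ∧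
    (∀ t : ℝ, 0 ≤ t → φ t ≠ 0 →
      ∃ L : ℝ,
        Tendsto (fun ε : ℝ =>
            ∫ u in Set.Icc 0 t \
              (⋃ z ∈ {z : ℝ | 0 ≤ z ∧ z < t ∧ φ z = 0}, Set.Icc (z - ε) (z + ε)),
              φ' u / φ u)
          (nhdsWithin 0 (Set.Ioi 0)) (𝓝 L) ∧
        φ t = φ 0 * (-1 : ℝ) ^ ({z : ℝ | 0 ≤ z ∧ z < t ∧ φ z = 0}.ncard) * Real.exp L) := by
  have hφ : ContinuousOn φ (Set.Ici 0) := fun u hu => (hderiv u hu).continuousWithinAt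
  refine ⟨finite_zeros_Icc hderiv hsimple,
    exists_continuousOn_onePoint_logDeriv hφ hcont hsimple, fun t ht hφt => ?_⟩
  obtain ⟨-, hT, hS⟩ := pv_logDeriv_and_sign hderiv hcont h0 hsimple _ t ht hφt rfl
  refine ⟨_, hT, ?_⟩
  rw [Real.exp_sub, Real.exp_log h0, Real.exp_log_eq_abs hφt]
  field_simp
  rcases neg_one_pow_eq_or ℝ (zerosBefore φ t).ncard with h | h <;> rw [h] at hS ⊢
  · rw [one_mul] at hS ⊢
    rw [abs_of_pos hS]
  · rw [abs_of_neg (by linarith)]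
    ring
end

section
/- For μ ≥ 0 let y_μ(t) = exp((4/3)·(t+μ)^{3/2}) and G_μ(t) = ∫_0^t y_μ(u)² du for t ≥ 0. Then: (i) for all t, μ ≥ 0, G_μ(t) ≤ y_μ(t)²/max(√(t+μ), 1), and hence log G_μ(t) ≤ (8/3)·(t+μ)^{3/2}; (ii) for all t, μ ≥ 0, G_μ(t)·(log(1 + G_μ(t)))^{1/3} ≤ 2·y_μ(t)²; (iii) for all t, μ ≥ 0 with t ≥ min(1, μ^{−1/2}) (where μ^{−1/2} := +∞ if μ = 0), G_μ(t) ≥ e^{−4}·y_μ(t)²/√(t+μ), and if in addition t + μ ≥ 4 then log G_μ(t) ≥ (t+μ)^{3/2}. -/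
open MeasureTheory Filter Topology Set

/-- `y_μ(t) = exp((4/3)(t+μ)^{3/2})`. -/
noncomputable def yfun (μ t : ℝ) : ℝ := Real.exp ((4 / 3) * (t + μ) ^ ((3 : ℝ) / 2))

/-- `G_μ(t) = ∫_0^t y_μ(u)² du`. -/
noncomputable def Gfun (μ t : ℝ) : ℝ := ∫ u in (0:ℝ)..t, (yfun μ u) ^ 2

theorem rpow_three_halves_eq_sqrt_pow {x : ℝ} (hx : 0 ≤ x) :
    x ^ ((3 : ℝ) / 2) = √x ^ 3 := by
  rw [Real.rpow_div_two_eq_sqrt _ hx]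
  exact_mod_cast Real.rpow_natCast (√x) 3

theorem yfun_sq {μ t : ℝ} (h : 0 ≤ t + μ) :
    yfun μ t ^ 2 = Real.exp (8 / 3 * √(t + μ) ^ 3) := by
  rw [yfun, rpow_three_halves_eq_sqrt_pow h, ← Real.exp_nat_mul]
  congr 1
  push_cast
  ring

theorem continuous_yfun_sq (μ : ℝ) : Continuous fun u => yfun μ u ^ 2 := by
  unfold yfun
  have h : Continuous fun u : ℝ => (u + μ) ^ ((3 : ℝ) / 2) :=
    (continuous_id.add continuous_const).rpow_const fun _ => Or.inr (by norm_num)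
  fun_prop

theorem yfun_sq_mono {μ u t : ℝ} (hu : 0 ≤ u + μ) (hut : u ≤ t) :
    yfun μ u ^ 2 ≤ yfun μ t ^ 2 := by
  rw [yfun_sq hu, yfun_sq (by linarith)]
  gcongr

/-- Chord bound: `v ^ (3/2) ≤ v * √s` for `0 ≤ v ≤ s`, exponentiated. -/
theorem yfun_sq_le {μ u t : ℝ} (hu : 0 ≤ u + μ) (hut : u ≤ t) :
    yfun μ u ^ 2 ≤ yfun μ t ^ 2 * Real.exp (√(t + μ) * (u - t)) := by
  have ht : 0 ≤ t + μ := by linarith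
  rw [yfun_sq hu, yfun_sq ht, ← Real.exp_add]
  have h1 := Real.sq_sqrt hu
  have h2 := Real.sq_sqrt ht
  have h3 : √(u + μ) ≤ √(t + μ) := Real.sqrt_le_sqrt (by linarith)
  have h4 := Real.sqrt_nonneg (u + μ)
  have h5 : u - t = √(u + μ) ^ 2 - √(t + μ) ^ 2 := by linarith
  rw [h5]
  set a := √(u + μ)
  set b := √(t + μ)
  gcongr
  have h6 : 0 ≤ a ^ 2 * (b - a) := mul_nonneg (sq_nonneg a) (by linarith)
  have h7 : 0 ≤ b * ((b - a) * (b + a)) :=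
    mul_nonneg (by linarith) (mul_nonneg (by linarith) (by linarith))
  nlinarith

/-- Tangent bound for `v ↦ v ^ (3/2)`, exponentiated. -/
theorem le_yfun_sq {μ u t : ℝ} (hu : 0 ≤ u + μ) (ht : 0 ≤ t + μ) :
    yfun μ t ^ 2 * Real.exp (-(4 * √(t + μ) * (t - u))) ≤ yfun μ u ^ 2 := by
  rw [yfun_sq hu, yfun_sq ht, ← Real.exp_add]
  have h1 := Real.sq_sqrt hu
  have h2 := Real.sq_sqrt ht
  have h3 := Real.sqrt_nonneg (t + μ)
  have h4 := Real.sqrt_nonneg (u + μ)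
  have h5 : t - u = √(t + μ) ^ 2 - √(u + μ) ^ 2 := by linarith
  rw [h5]
  set a := √(u + μ)
  set b := √(t + μ)
  gcongr
  have h6 : 0 ≤ (a - b) ^ 2 * (2 * a + b) := mul_nonneg (sq_nonneg _) (by linarith)
  nlinarith

theorem integral_exp_mul_sub_le {c : ℝ} (hc : 0 < c) (t : ℝ) :
    ∫ u in (0 : ℝ)..t, Real.exp (c * (u - t)) ≤ 1 / c := by
  have hderiv : ∀ u ∈ uIcc 0 t,
      HasDerivAt (fun u => Real.exp (c * (u - t)) / c) (Real.exp (c * (u - t))) u := by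
    intro u _
    have h := ((((hasDerivAt_id' u).sub_const t).const_mul c).exp).div_const c
    exact h.congr_deriv (by field_simp)
  rw [intervalIntegral.integral_eq_sub_of_hasDerivAt hderiv
    (Continuous.intervalIntegrable (by fun_prop) _ _)]
  simp only [sub_self, mul_zero, Real.exp_zero]
  have : 0 ≤ Real.exp (c * (0 - t)) / c := by positivity
  linarith

theorem Gfun_nonneg (μ : ℝ) {t : ℝ} (ht : 0 ≤ t) : 0 ≤ Gfun μ t :=
  intervalIntegral.integral_nonneg ht fun _ _ => sq_nonneg _

theorem Gfun_le_div_max {μ t : ℝ} (hμ : 0 ≤ μ) (ht : 0 ≤ t) :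
    Gfun μ t ≤ yfun μ t ^ 2 / max √(t + μ) 1 := by
  have hint := (continuous_yfun_sq μ).intervalIntegrable (μ := volume) 0 t
  rcases le_total √(t + μ) 1 with hs | hs
  · rw [max_eq_right hs, div_one]
    have h1 : t + μ ≤ 1 := by simpa using hs
    calc Gfun μ t ≤ ∫ _ in (0 : ℝ)..t, yfun μ t ^ 2 :=
          intervalIntegral.integral_mono_on ht hint intervalIntegrable_const
            fun u hu => yfun_sq_mono (by linarith [hu.1]) hu.2
      _ = t * yfun μ t ^ 2 := by simp
      _ ≤ 1 * yfun μ t ^ 2 := by gcongr; linarith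
      _ = yfun μ t ^ 2 := one_mul _
  · rw [max_eq_left hs]
    have hc : 0 < √(t + μ) := by linarith
    calc Gfun μ t ≤ ∫ u in (0 : ℝ)..t, yfun μ t ^ 2 * Real.exp (√(t + μ) * (u - t)) :=
          intervalIntegral.integral_mono_on ht hint
            (Continuous.intervalIntegrable (by fun_prop) _ _)
            fun u hu => yfun_sq_le (by linarith [hu.1]) hu.2
      _ = yfun μ t ^ 2 * ∫ u in (0 : ℝ)..t, Real.exp (√(t + μ) * (u - t)) :=
          intervalIntegral.integral_const_mul _ _
      _ ≤ yfun μ t ^ 2 * (1 / √(t + μ)) := by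
          gcongr
          exact integral_exp_mul_sub_le hc t
      _ = yfun μ t ^ 2 / √(t + μ) := by ring

theorem Gfun_le_yfun_sq {μ t : ℝ} (hμ : 0 ≤ μ) (ht : 0 ≤ t) : Gfun μ t ≤ yfun μ t ^ 2 :=
  (Gfun_le_div_max hμ ht).trans (div_le_self (sq_nonneg _) (le_max_right _ _))

theorem log_Gfun_le {μ t : ℝ} (hμ : 0 ≤ μ) (ht : 0 ≤ t) :
    Real.log (Gfun μ t) ≤ 8 / 3 * √(t + μ) ^ 3 := by
  rcases (Gfun_nonneg μ ht).eq_or_lt with h | h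
  · rw [← h, Real.log_zero]
    positivity
  · rw [Real.log_le_iff_le_exp h, ← yfun_sq (by linarith)]
    exact Gfun_le_yfun_sq hμ ht

theorem Gfun_mul_log_rpow_le {μ t : ℝ} (hμ : 0 ≤ μ) (ht : 0 ≤ t) :
    Gfun μ t * Real.log (1 + Gfun μ t) ^ ((1 : ℝ) / 3) ≤ 2 * yfun μ t ^ 2 := by
  have hG := Gfun_nonneg μ ht
  have hGE := Gfun_le_yfun_sq hμ ht
  have hmax := Gfun_le_div_max hμ ht
  set m := max √(t + μ) 1
  have hm1 : 1 ≤ m := le_max_right _ _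
  have hsm : √(t + μ) ^ 3 ≤ m ^ 3 := by
    gcongr
    exact le_max_left _ _
  have hlog : Real.log (1 + Gfun μ t) ≤ (2 * m) ^ 3 := by
    rw [Real.log_le_iff_le_exp (by linarith)]
    have hE : 1 ≤ Real.exp (8 / 3 * √(t + μ) ^ 3) := Real.one_le_exp (by positivity)
    rw [yfun_sq (by linarith)] at hGE
    have h2 : 2 ≤ Real.exp 1 := by linarith [Real.add_one_le_exp 1]
    calc 1 + Gfun μ t ≤ 2 * Real.exp (8 / 3 * √(t + μ) ^ 3) := by linarith
      _ ≤ Real.exp 1 * Real.exp (8 / 3 * √(t + μ) ^ 3) := by gcongr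
      _ = Real.exp (1 + 8 / 3 * √(t + μ) ^ 3) := (Real.exp_add _ _).symm
      _ ≤ Real.exp ((2 * m) ^ 3) := by
        gcongr
        have : 1 ≤ m ^ 3 := one_le_pow₀ hm1
        nlinarith
  have hroot : Real.log (1 + Gfun μ t) ^ ((1 : ℝ) / 3) ≤ 2 * m := by
    calc Real.log (1 + Gfun μ t) ^ ((1 : ℝ) / 3) ≤ ((2 * m) ^ 3) ^ ((1 : ℝ) / 3) :=
          Real.rpow_le_rpow (Real.log_nonneg (by linarith)) hlog (by norm_num)
      _ = 2 * m := by
          rw [one_div]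
          exact_mod_cast Real.pow_rpow_inv_natCast (n := 3) (by linarith : 0 ≤ 2 * m) (by norm_num)
  calc Gfun μ t * Real.log (1 + Gfun μ t) ^ ((1 : ℝ) / 3)
      ≤ yfun μ t ^ 2 / m * (2 * m) :=
        mul_le_mul hmax hroot (Real.rpow_nonneg (Real.log_nonneg (by linarith)) _)
          (by positivity)
    _ = 2 * yfun μ t ^ 2 := by
      have : m ≠ 0 := by linarith
      field_simp

theorem le_Gfun {μ t : ℝ} (hμ : 0 ≤ μ) (ht : 0 ≤ t) (hst : 1 ≤ √(t + μ) * t) :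
    Real.exp (-4) * yfun μ t ^ 2 / √(t + μ) ≤ Gfun μ t := by
  have hb : 0 < √(t + μ) := by
    by_contra! h
    nlinarith
  have hδ : 1 / √(t + μ) ≤ t := by
    rw [div_le_iff₀ hb]
    linarith
  have hδ0 : 0 ≤ 1 / √(t + μ) := by positivity
  have hcont := continuous_yfun_sq μ
  calc Real.exp (-4) * yfun μ t ^ 2 / √(t + μ)
      = ∫ _ in (t - 1 / √(t + μ))..t, Real.exp (-4) * yfun μ t ^ 2 := by
        rw [intervalIntegral.integral_const, smul_eq_mul]
        ring
    _ ≤ ∫ u in (t - 1 / √(t + μ))..t, yfun μ u ^ 2 := by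
        refine intervalIntegral.integral_mono_on (by linarith) intervalIntegrable_const
          (hcont.intervalIntegrable _ _) fun u hu => ?_
        refine le_trans ?_ (le_yfun_sq (t := t) (by linarith [hu.1]) (by linarith))
        rw [mul_comm]
        gcongr
        have h1 : √(t + μ) * (t - u) ≤ √(t + μ) * (1 / √(t + μ)) := by
          gcongr
          linarith [hu.1]
        rw [mul_one_div_cancel hb.ne'] at h1
        linarith
    _ ≤ Gfun μ t :=
        intervalIntegral.integral_mono_interval (by linarith) (by linarith) le_rfl
          (ae_of_all _ fun _ => sq_nonneg _) (hcont.intervalIntegrable _ _)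

theorem le_log_Gfun {μ t : ℝ} (hμ : 0 ≤ μ) (ht : 0 ≤ t) (hst : 1 ≤ √(t + μ) * t)
    (h4 : 4 ≤ t + μ) : √(t + μ) ^ 3 ≤ Real.log (Gfun μ t) := by
  have hG := le_Gfun hμ ht hst
  have hb : 2 ≤ √(t + μ) := Real.le_sqrt_of_sq_le (by linarith)
  rw [yfun_sq (by linarith)] at hG
  set b := √(t + μ)
  have hpos : 0 < Real.exp (-4) * Real.exp (8 / 3 * b ^ 3) / b := by positivity
  refine le_trans ?_ (Real.log_le_log hpos hG)
  rw [← Real.exp_add, Real.log_div (Real.exp_ne_zero _) (by linarith), Real.log_exp]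
  have hlog := Real.log_le_sub_one_of_pos (by linarith : 0 < b)
  have hcube : 4 * b ≤ b ^ 3 := by
    nlinarith [mul_nonneg (by linarith : 0 ≤ b) (by nlinarith : 0 ≤ b ^ 2 - 4)]
  linarith

theorem one_le_sqrt_mul {μ t : ℝ} (hμ : 0 ≤ μ) (ht : 0 ≤ t)
    (h : 1 ≤ t ∨ (μ ≠ 0 ∧ μ ^ (-(1 : ℝ) / 2) ≤ t)) : 1 ≤ √(t + μ) * t := by
  rcases h with h | ⟨hμ0, h⟩
  · exact one_le_mul_of_one_le_of_one_le (Real.one_le_sqrt.2 (by linarith)) h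
  · have hμpos : 0 < √μ := Real.sqrt_pos.2 (hμ.lt_of_ne' hμ0)
    rw [neg_div, Real.rpow_neg hμ, ← Real.sqrt_eq_rpow] at h
    calc (1 : ℝ) = √μ * (√μ)⁻¹ := (mul_inv_cancel₀ hμpos.ne').symm
      _ ≤ √(t + μ) * t := by
        gcongr
        linarith

/-- Deterministic estimates on `G_μ`: upper bounds (i), (ii) and the lower
bound (iii) valid for `t ≥ min(1, μ^{−1/2})` (with `μ^{−1/2} = +∞` if `μ = 0`). -/
theorem stmt13 (μ : ℝ) (hμ : 0 ≤ μ) (t : ℝ) (ht : 0 ≤ t) :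
    (Gfun μ t ≤ (yfun μ t) ^ 2 / max (Real.sqrt (t + μ)) 1 ∧
      Real.log (Gfun μ t) ≤ (8 / 3) * (t + μ) ^ ((3 : ℝ) / 2)) ∧
    (Gfun μ t * (Real.log (1 + Gfun μ t)) ^ ((1 : ℝ) / 3) ≤ 2 * (yfun μ t) ^ 2) ∧
    ((1 ≤ t ∨ (μ ≠ 0 ∧ μ ^ (-(1 : ℝ) / 2) ≤ t)) →
      Real.exp (-4) * (yfun μ t) ^ 2 / Real.sqrt (t + μ) ≤ Gfun μ t ∧
        (4 ≤ t + μ → (t + μ) ^ ((3 : ℝ) / 2) ≤ Real.log (Gfun μ t))) := by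
  rw [rpow_three_halves_eq_sqrt_pow (by linarith : 0 ≤ t + μ)]
  refine ⟨⟨Gfun_le_div_max hμ ht, log_Gfun_le hμ ht⟩, Gfun_mul_log_rpow_le hμ ht, fun h => ?_⟩
  have hst := one_le_sqrt_mul hμ ht h
  exact ⟨le_Gfun hμ ht hst, le_log_Gfun hμ ht hst⟩
end

section
/- Let κ, σ ∈ (0,1), c ≥ 1 and R ≥ 2. There are constants C = C(σ, c) and N₀ = N₀(σ) such that the following holds for every integer N ≥ N₀. Set B_κ = { λ ∈ ℂ : |λ| ≤ (log N)^{1−κ} } and B̂_κ = 2B_κ ∩ N^{−R}·(ℤ + iℤ). Suppose φ : 2B_κ → ℂ satisfies |φ(z)| ≤ c·|φ(w)| for all z, w ∈ 2B_κ with |z − w| ≤ N^{−σ}. Then for every polynomial Q with complex coefficients of degree at most N: sup{ |φ(u)·(Q(u) − Q(v))| : u, v ∈ B_κ, |u − v| ≤ N^{−R} } ≤ C·N^{1+3σ−R}·max_{v ∈ B̂_κ} |φ(v)·Q(v)|. -/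
open MeasureTheory Filter Topology Set

/-- Bernstein–Walsh growth for the unit disc: a polynomial of degree at most `N` bounded by `M` on
the unit circle is bounded by `‖z‖ ^ N * M` outside the unit disc. -/
theorem Polynomial.norm_eval_le_pow_mul_of_sphere {P : Polynomial ℂ} {N : ℕ} (hP : P.natDegree ≤ N)
    {M : ℝ} (hM : ∀ z : ℂ, ‖z‖ = 1 → ‖P.eval z‖ ≤ M) {z : ℂ} (hz : 1 ≤ ‖z‖) :
    ‖P.eval z‖ ≤ ‖z‖ ^ N * M := by
  have key : ∀ x : ℂ, x ≠ 0 → (P.reflect N).eval x⁻¹ * x ^ N = P.eval x := by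
    intro x hx
    let := invertibleOfNonzero hx
    have := Polynomial.eval₂_reflect_mul_pow (RingHom.id ℂ) x N P hP
    simpa [Polynomial.eval₂_id, invOf_eq_inv] using this
  have hz0 : z ≠ 0 := norm_pos_iff.1 (by linarith)
  have hrefl : ‖(P.reflect N).eval z⁻¹‖ ≤ M := by
    refine Complex.norm_le_of_forall_mem_frontier_norm_le (U := Metric.ball (0 : ℂ) 1)
      (f := fun x => (P.reflect N).eval x) Metric.isBounded_ball
      (P.reflect N).differentiable.diffContOnCl ?_ ?_
    · intro w hw
      rw [frontier_ball _ one_ne_zero, mem_sphere_zero_iff_norm] at hw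
      have hw0 : w ≠ 0 := norm_pos_iff.1 (by linarith)
      have h1 := key w⁻¹ (inv_ne_zero hw0)
      have h2 := hM w⁻¹ (by simp [hw])
      rw [← h1] at h2
      simpa [hw] using h2
    · rw [closure_ball _ one_ne_zero, mem_closedBall_zero_iff, norm_inv]
      exact inv_le_one_of_one_le₀ hz
  rw [← key z hz0, norm_mul, norm_pow, mul_comm]
  gcongr

/-- Bernstein–Walsh growth for an arbitrary disc. -/
theorem Polynomial.norm_eval_le_pow_mul_of_closedBall {Q : Polynomial ℂ} {N : ℕ}
    (hQ : Q.natDegree ≤ N) {u : ℂ} {r M : ℝ} (hr : 0 < r)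
    (hM : ∀ z ∈ Metric.closedBall u r, ‖Q.eval z‖ ≤ M) {t : ℝ} (ht : 1 ≤ t) {z : ℂ}
    (hz : dist z u ≤ t * r) : ‖Q.eval z‖ ≤ t ^ N * M := by
  have hM0 : 0 ≤ M := (norm_nonneg _).trans (hM u (Metric.mem_closedBall_self hr.le))
  by_cases h : dist z u ≤ r
  · exact (hM z h).trans (le_mul_of_one_le_left hM0 (one_le_pow₀ ht))
  set P : Polynomial ℂ := Q.comp (Polynomial.C (r : ℂ) * Polynomial.X + Polynomial.C u) with hPdef
  have hP : P.natDegree ≤ N := by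
    refine Polynomial.natDegree_comp_le.trans ?_
    calc Q.natDegree * _ ≤ Q.natDegree * 1 := by
          gcongr; exact Polynomial.natDegree_linear_le
      _ ≤ N := by simpa using hQ
  have hev : ∀ x, P.eval x = Q.eval (r * x + u) := by intro x; simp [hPdef]
  have hr0 : (r : ℂ) ≠ 0 := by exact_mod_cast hr.ne'
  set x : ℂ := (z - u) / r with hx
  have hxn : ‖x‖ = dist z u / r := by
    rw [hx, norm_div, Complex.norm_real, Real.norm_of_nonneg hr.le, dist_eq_norm]
  have h1 : 1 ≤ ‖x‖ := by rw [hxn, le_div_iff₀ hr]; linarith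
  have h2 : ‖x‖ ≤ t := by rw [hxn, div_le_iff₀ hr]; exact hz
  have h3 : P.eval x = Q.eval z := by
    rw [hev, hx, mul_div_cancel₀ _ hr0, sub_add_cancel]
  have h4 := Polynomial.norm_eval_le_pow_mul_of_sphere hP (M := M) (fun w hw => by
    rw [hev]
    refine hM _ ?_
    simp [dist_eq_norm, hw, abs_of_pos hr]) h1
  rw [h3] at h4
  exact h4.trans (by gcongr)

/-- Bernstein's inequality up to a constant, on a closed disc. -/
theorem Polynomial.norm_deriv_eval_le_of_closedBall {Q : Polynomial ℂ} {N : ℕ} (hN : 1 ≤ N)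
    (hQ : Q.natDegree ≤ N) {u : ℂ} {r M : ℝ} (hr : 0 < r)
    (hM : ∀ z ∈ Metric.closedBall u r, ‖Q.eval z‖ ≤ M) {z : ℂ}
    (hz : z ∈ Metric.closedBall u r) : ‖deriv (fun x => Q.eval x) z‖ ≤ 3 * N / r * M := by
  have hN' : (0 : ℝ) < N := by exact_mod_cast hN
  have hM0 : 0 ≤ M := (norm_nonneg _).trans (hM z hz)
  have h := Complex.norm_deriv_le_of_forall_mem_sphere_norm_le (c := z) (R := r / N) (C := 3 * M)
    (f := fun x => Q.eval x) (by positivity) Q.differentiable.diffContOnCl (fun w hw => by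
      have hd : dist w u ≤ (1 + (N : ℝ)⁻¹) * r := by
        calc dist w u ≤ dist w z + dist z u := dist_triangle _ _ _
          _ ≤ r / N + r := add_le_add (Metric.mem_sphere.1 hw).le hz
          _ = _ := by ring
      have ht : (1 : ℝ) ≤ 1 + (N : ℝ)⁻¹ := by
        have : (0 : ℝ) ≤ (N : ℝ)⁻¹ := by positivity
        linarith
      refine (Polynomial.norm_eval_le_pow_mul_of_closedBall hQ hr hM ht hd).trans ?_
      gcongr
      exact Real.one_add_inv_pow_le_exp.trans Real.exp_one_lt_three.le)
  refine h.trans (le_of_eq ?_)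
  field_simp

/-- Lipschitz form of Bernstein's inequality on a closed disc. -/
theorem Polynomial.norm_eval_sub_le_of_closedBall {Q : Polynomial ℂ} {N : ℕ} (hN : 1 ≤ N)
    (hQ : Q.natDegree ≤ N) {u : ℂ} {r M : ℝ} (hr : 0 < r)
    (hM : ∀ z ∈ Metric.closedBall u r, ‖Q.eval z‖ ≤ M) {z w : ℂ}
    (hz : z ∈ Metric.closedBall u r) (hw : w ∈ Metric.closedBall u r) :
    ‖Q.eval z - Q.eval w‖ ≤ 3 * N / r * M * dist z w := by
  rw [dist_eq_norm]
  exact Convex.norm_image_sub_le_of_norm_deriv_le (f := fun x => Q.eval x)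
    (fun x _ => Q.differentiableAt)
    (fun x hx => Polynomial.norm_deriv_eval_le_of_closedBall hN hQ hr hM hx)
    (convex_closedBall u r) hw hz

/-- Every complex number is within `h` of the lattice `h (ℤ + iℤ)`. -/
theorem Complex.exists_dist_smul_gaussian_le {h : ℝ} (hh : 0 < h) (p : ℂ) :
    ∃ a b : ℤ, dist p ((h : ℂ) * ((a : ℂ) + (b : ℂ) * Complex.I)) ≤ h := by
  refine ⟨round (p.re / h), round (p.im / h), ?_⟩
  have aux : ∀ x : ℝ, |x - h * round (x / h)| ≤ h / 2 := by
    intro x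
    have h1 := abs_sub_round (x / h)
    have h2 : x - h * round (x / h) = h * (x / h - round (x / h)) := by field_simp
    rw [h2, abs_mul, abs_of_pos hh]
    nlinarith
  rw [dist_eq_norm]
  refine (Complex.norm_le_abs_re_add_abs_im _).trans ?_
  have h1 := aux p.re
  have h2 := aux p.im
  simp only [Complex.sub_re, Complex.sub_im, Complex.mul_re, Complex.mul_im, Complex.add_re,
    Complex.add_im, Complex.ofReal_re, Complex.ofReal_im, Complex.intCast_re, Complex.intCast_im,
    Complex.I_re, Complex.I_im]
  ring_nf at h1 h2 ⊢
  linarith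

/-- Discretisation: if the mesh `h` is at most `r / (12 N)`, the supremum over a disc of radius `r`
of a polynomial of degree at most `N` is at most twice its maximum over the lattice points. -/
theorem Polynomial.norm_eval_le_two_mul_of_lattice {Q : Polynomial ℂ} {N : ℕ} (hN : 1 ≤ N)
    (hQ : Q.natDegree ≤ N) {u : ℂ} {r h A : ℝ} (hh : 0 < h) (hhr : 12 * N * h ≤ r)
    (hA : ∀ a b : ℤ, (h : ℂ) * ((a : ℂ) + (b : ℂ) * Complex.I) ∈ Metric.closedBall u r →
      ‖Q.eval ((h : ℂ) * ((a : ℂ) + (b : ℂ) * Complex.I))‖ ≤ A) {z : ℂ}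
    (hz : z ∈ Metric.closedBall u r) : ‖Q.eval z‖ ≤ 2 * A := by
  have hN' : (1 : ℝ) ≤ N := by exact_mod_cast hN
  have hr : 0 < r := lt_of_lt_of_le (by positivity) hhr
  have hle : h ≤ r := by nlinarith
  obtain ⟨x, hx, hmax⟩ := (isCompact_closedBall u r).exists_isMaxOn
    (Metric.nonempty_closedBall.2 hr.le) (Q.continuous.norm.continuousOn)
  have hM : ∀ w ∈ Metric.closedBall u r, ‖Q.eval w‖ ≤ ‖Q.eval x‖ := fun w hw => hmax hw
  have hxu : ‖x - u‖ ≤ r := by simpa [dist_eq_norm] using hx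
  set p : ℂ := u + ((1 - h / r : ℝ) : ℂ) * (x - u) with hp
  have hq : h / r ≤ 1 := (div_le_one hr).2 hle
  have hpu : dist p u ≤ r - h := by
    have : p - u = ((1 - h / r : ℝ) : ℂ) * (x - u) := by rw [hp]; ring
    rw [dist_eq_norm, this, norm_mul, Complex.norm_real, Real.norm_of_nonneg (by linarith)]
    calc (1 - h / r) * ‖x - u‖ ≤ (1 - h / r) * r := by
          apply mul_le_mul_of_nonneg_left hxu; linarith
      _ = r - h := by field_simp
  have hxp : dist x p ≤ h := by
    have : x - p = ((h / r : ℝ) : ℂ) * (x - u) := by rw [hp]; push_cast; ring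
    rw [dist_eq_norm, this, norm_mul, Complex.norm_real, Real.norm_of_nonneg (by positivity)]
    calc (h / r) * ‖x - u‖ ≤ (h / r) * r := by gcongr
      _ = h := by field_simp
  obtain ⟨a, b, hab⟩ := Complex.exists_dist_smul_gaussian_le hh p
  have hAab := hA a b
  set w : ℂ := (h : ℂ) * ((a : ℂ) + (b : ℂ) * Complex.I)
  have hw : w ∈ Metric.closedBall u r := by
    rw [Metric.mem_closedBall]
    have := dist_triangle w p u
    rw [dist_comm w p] at this
    linarith
  have hxw : dist x w ≤ 2 * h := by linarith [dist_triangle x p w]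
  have hL := Polynomial.norm_eval_sub_le_of_closedBall hN hQ hr hM hx hw
  have hhalf : 3 * N / r * ‖Q.eval x‖ * dist x w ≤ ‖Q.eval x‖ / 2 := by
    calc 3 * N / r * ‖Q.eval x‖ * dist x w ≤ 3 * N / r * ‖Q.eval x‖ * (2 * h) := by gcongr
      _ = (12 * N * h) * (‖Q.eval x‖ / (2 * r)) := by field_simp; ring
      _ ≤ r * (‖Q.eval x‖ / (2 * r)) := by gcongr
      _ = ‖Q.eval x‖ / 2 := by field_simp
  have h1 := hAab hw
  have h2 := norm_sub_norm_le (Q.eval x) (Q.eval w)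
  linarith [hM z hz]

/-- Continuity estimate for polynomials of degree at most `N` against a weight `φ`
with slowly varying modulus, over the disc `B_κ = {|λ| ≤ (log N)^{1−κ}}`, in terms
of the values on the lattice points `B̂_κ = 2B_κ ∩ N^{−R}(ℤ + iℤ)`. -/
theorem stmt15 (σ c : ℝ) (hσ0 : 0 < σ) (hσ1 : σ < 1) (hc : 1 ≤ c) :
    ∃ C : ℝ, 0 < C ∧ ∃ N₀ : ℕ, ∀ κ R : ℝ, 0 < κ → κ < 1 → 2 ≤ R →
      ∀ N : ℕ, N₀ ≤ N →
      ∀ φ : ℂ → ℂ,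
        (∀ z ∈ Metric.closedBall (0 : ℂ) (2 * (Real.log N) ^ ((1 : ℝ) - κ)),
         ∀ w ∈ Metric.closedBall (0 : ℂ) (2 * (Real.log N) ^ ((1 : ℝ) - κ)),
          dist z w ≤ (N : ℝ) ^ (-σ) → ‖φ z‖ ≤ c * ‖φ w‖) →
      ∀ Q : Polynomial ℂ, Q.natDegree ≤ N →
      ∀ u ∈ Metric.closedBall (0 : ℂ) ((Real.log N) ^ ((1 : ℝ) - κ)),
      ∀ v ∈ Metric.closedBall (0 : ℂ) ((Real.log N) ^ ((1 : ℝ) - κ)),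
        dist u v ≤ (N : ℝ) ^ (-R) →
      ∀ m : ℝ,
        (∀ w ∈ Metric.closedBall (0 : ℂ) (2 * (Real.log N) ^ ((1 : ℝ) - κ)),
          (∃ a b : ℤ, w = (((N : ℝ) ^ (-R) : ℝ) : ℂ) * ((a : ℂ) + (b : ℂ) * Complex.I)) →
          ‖φ w * Q.eval w‖ ≤ m) →
        ‖φ u * (Q.eval u - Q.eval v)‖ ≤ C * (N : ℝ) ^ (1 + 3 * σ - R) * m := by
  obtain ⟨N₁, hN₁⟩ := ((tendsto_rpow_atTop (sub_pos.2 hσ1)).comp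
    tendsto_natCast_atTop_atTop).eventually_ge_atTop (12 : ℝ) |>.exists_forall_of_atTop
  refine ⟨6 * c, by linarith, max N₁ 3, ?_⟩
  intro κ R hκ0 hκ1 hR N hN φ hφ Q hQ u hu v hv huv m hm
  have hN3 : (3 : ℝ) ≤ N := by exact_mod_cast (le_max_right _ _).trans hN
  have hN12 : (12 : ℝ) ≤ (N : ℝ) ^ (1 - σ) := hN₁ N ((le_max_left _ _).trans hN)
  have hN0 : (0 : ℝ) < N := by linarith
  have hN1 : (1 : ℝ) ≤ N := by linarith
  set L : ℝ := (Real.log N) ^ ((1 : ℝ) - κ)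
  have hL : 1 ≤ L := by
    apply Real.one_le_rpow _ (by linarith)
    rw [Real.le_log_iff_exp_le hN0]
    linarith [Real.exp_one_lt_three]
  set r : ℝ := (N : ℝ) ^ (-σ) with hrdef
  set h : ℝ := (N : ℝ) ^ (-R) with hhdef
  have hr : 0 < r := Real.rpow_pos_of_pos hN0 _
  have hh : 0 < h := Real.rpow_pos_of_pos hN0 _
  have hr1 : r ≤ 1 := Real.rpow_le_one_of_one_le_of_nonpos hN1 (by linarith)
  have hsub : ∀ w ∈ Metric.closedBall u r, w ∈ Metric.closedBall (0 : ℂ) (2 * L) := by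
    intro w hw
    rw [Metric.mem_closedBall] at *
    linarith [dist_triangle w u 0]
  have hm0 : 0 ≤ m := by
    refine (norm_nonneg _).trans (hm 0 (Metric.mem_closedBall_self (by linarith)) ⟨0, 0, ?_⟩)
    simp
  rcases eq_or_ne (φ u) 0 with h0 | h0
  · rw [h0, zero_mul, norm_zero]
    positivity
  have hφ0 : 0 < ‖φ u‖ := norm_pos_iff.2 h0
  have hhr : 12 * N * h ≤ r := by
    calc 12 * N * h ≤ (N : ℝ) ^ (1 - σ) * N * (N : ℝ) ^ (-2 : ℝ) := by
          gcongr
          exact Real.rpow_le_rpow_of_exponent_le hN1 (by linarith)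
      _ = (N : ℝ) ^ (1 - σ + 1 + -2) := by
          rw [Real.rpow_add hN0, Real.rpow_add_one hN0.ne']
      _ = r := by rw [hrdef]; congr 1; ring
  have hle : h ≤ r := by nlinarith
  have hNat : 1 ≤ N := by exact_mod_cast hN1
  have hu' : u ∈ Metric.closedBall u r := Metric.mem_closedBall_self hr.le
  have hv' : v ∈ Metric.closedBall u r := by
    rw [Metric.mem_closedBall, dist_comm]; linarith
  have hM : ∀ z ∈ Metric.closedBall u r, ‖Q.eval z‖ ≤ 2 * (c * m / ‖φ u‖) := by
    intro z hz
    refine Polynomial.norm_eval_le_two_mul_of_lattice hNat hQ hh hhr (fun a b hab => ?_) hz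
    have h1 := hm _ (hsub _ hab) ⟨a, b, rfl⟩
    have h2 := hφ u (hsub u hu') _ (hsub _ hab) (by rw [dist_comm]; exact hab)
    rw [norm_mul] at h1
    rw [le_div_iff₀ hφ0]
    set w : ℂ := (h : ℂ) * ((a : ℂ) + (b : ℂ) * Complex.I)
    calc ‖Q.eval w‖ * ‖φ u‖ ≤ ‖Q.eval w‖ * (c * ‖φ w‖) := by gcongr
      _ = c * (‖φ w‖ * ‖Q.eval w‖) := by ring
      _ ≤ c * m := by gcongr
  have hlip := Polynomial.norm_eval_sub_le_of_closedBall hNat hQ hr hM hu' hv'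
  have hpow : N / r * h ≤ (N : ℝ) ^ (1 + 3 * σ - R) := by
    calc N / r * h = (N : ℝ) ^ (1 + σ + -R) := by
          rw [hrdef, Real.rpow_neg hN0.le, div_inv_eq_mul, Real.rpow_add hN0, Real.rpow_add hN0,
            Real.rpow_one]
      _ ≤ (N : ℝ) ^ (1 + 3 * σ - R) := Real.rpow_le_rpow_of_exponent_le hN1 (by linarith)
  rw [norm_mul]
  calc ‖φ u‖ * ‖Q.eval u - Q.eval v‖
      ≤ ‖φ u‖ * (3 * N / r * (2 * (c * m / ‖φ u‖)) * h) := by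
        gcongr
        exact hlip.trans (by gcongr)
    _ = 6 * c * (N / r * h) * m := by field_simp; ring
    _ ≤ 6 * c * (N : ℝ) ^ (1 + 3 * σ - R) * m := by gcongr
end
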